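/- arXiv:2408.07034 — 4 statements merged into one kernel-verified Lean document; each statement's English description precedes it below -/
import Mathlib

section
/- Let p be a prime with p ≡ 3 (mod 4). Then for all rational numbers x, y, z, w, the determinant of the (p-1)/2 × (p-1)/2 matrix [x + ((i-j)/p) + (i/p)y + (j/p)z + (ij/p)w]_{0 ≤ i,j ≤ (p-3)/2} equals x. -/
open Matrix

/-- The determinant of a rank-one perturbation is affine in the row vector. -/
theorem Matrix.exists_det_add_vecMulVec {m R : Type*} [Fintype m] [DecidableEq m] [CommRing R]
    (X : Matrix m m R) (u : m → R) :
    ∃ l : (m → R) →ₗ[R] R, ∀ v, (X + vecMulVec u v).det = X.det + l v := by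
  let N : Matrix (Unit ⊕ m) (Unit ⊕ m) R := fromBlocks 1 0 (replicateCol Unit u) X
  let L : (Unit ⊕ m → R) →ₗ[R] R :=
    (detRowAlternating (n := Unit ⊕ m) (R := R)).toMultilinearMap.toLinearMap N (Sum.inl ())
  let e : (m → R) →ₗ[R] (Unit ⊕ m → R) :=
    { toFun := fun v => Sum.elim (0 : Unit → R) (-v)
      map_add' := by intro a b; ext (_ | _) <;> simp [add_comm]
      map_smul' := by intro a b; ext (_ | _) <;> simp }
  have key : ∀ v, (X + vecMulVec u v).det = L (Sum.elim (1 : Unit → R) (0 : m → R)) + L (e v) := by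
    intro v
    rw [← map_add]
    have h1 : N.updateRow (Sum.inl ()) (Sum.elim (1 : Unit → R) (0 : m → R) + e v) =
        fromBlocks 1 (-replicateRow Unit v) (replicateCol Unit u) X := by
      ext (i | i) (j | j) <;> simp [N, e, Matrix.updateRow_apply]
    have h2 : (X + vecMulVec u v).det =
        (N.updateRow (Sum.inl ()) (Sum.elim (1 : Unit → R) (0 : m → R) + e v)).det := by
      rw [h1, det_fromBlocks_one₁₁]
      congr 1
      ext i j
      simp [vecMulVec_apply, Matrix.mul_apply]
    exact h2
  refine ⟨L.comp e, fun v => ?_⟩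
  have h0 := key 0
  rw [map_zero, map_zero, add_zero, vecMulVec_zero, add_zero] at h0
  rw [key, h0]
  rfl

theorem Matrix.det_add_vecMulVec_row {m R : Type*} [Fintype m] [DecidableEq m] [CommRing R]
    (X : Matrix m m R) (u : m → R) (i : m) :
    (X + vecMulVec u (X i)).det = (1 + u i) * X.det := by
  have : X + vecMulVec u (X i) =
      (1 + replicateCol Unit u * replicateRow Unit (Pi.single i (1 : R))) * X := by
    rw [add_mul, one_mul, Matrix.mul_assoc]
    congr 1
    ext j k
    simp [vecMulVec_apply, Matrix.mul_apply, Pi.single_apply]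
  rw [this, det_mul, det_one_add_replicateCol_mul_replicateRow, single_one_dotProduct]

/-- If `X` is singular, multiples of a row of `X` may be dropped from the row vector of a rank-one
perturbation. -/
theorem Matrix.det_add_vecMulVec_smul_add_smul_row {m R : Type*} [Fintype m] [DecidableEq m]
    [CommRing R] {X : Matrix m m R} (hX : X.det = 0) (u v : m → R) (i : m) (x z : R) :
    (X + vecMulVec u (x • v + z • X i)).det = x * (X + vecMulVec u v).det := by
  obtain ⟨l, hl⟩ := X.exists_det_add_vecMulVec u
  have hi : l (X i) = 0 := by
    have := X.det_add_vecMulVec_row u i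
    rwa [hl, hX, mul_zero, zero_add] at this
  simp [hl, hX, hi]

theorem Matrix.det_eq_zero_of_transpose_eq_neg {m F : Type*} [Fintype m] [DecidableEq m]
    [Field F] [CharZero F] {M : Matrix m m F} (hM : Mᵀ = -M) (hm : Odd (Fintype.card m)) :
    M.det = 0 := by
  have h := M.det_transpose
  rw [hM, det_neg, hm.neg_one_pow, neg_one_mul] at h
  exact self_eq_neg.mp h.symm

/-- A skew-symmetric matrix of odd order with column `s` at `k`, perturbed by the span of
`1 1ᵀ`, `s 1ᵀ`, `1 sᵀ`, `s sᵀ`. -/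
theorem Matrix.det_skew_add_perturbation {m F : Type*} [Fintype m] [DecidableEq m]
    [Field F] [CharZero F] {M : Matrix m m F} (hM : Mᵀ = -M) (hm : Odd (Fintype.card m))
    (k : m) (x y z w : F) :
    (of fun i j => x + M i j + M i k * y + M j k * z + M i k * M j k * w).det =
      x * (of fun i j => 1 + M i j).det := by
  have hskew : ∀ i j, M i j = -M j i := fun i j => by
    rw [← Matrix.neg_apply, ← hM, transpose_apply]
  have hkk : M k k = 0 := self_eq_neg.mp (hskew k k)
  have hdet := det_eq_zero_of_transpose_eq_neg hM hm
  -- the coefficient of `1 sᵀ` is irrelevant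
  have drop_z : ∀ x y z w : F,
      (of fun i j => x + M i j + M i k * y + M j k * z + M i k * M j k * w).det =
        x * (of fun i j => 1 + M i j + M i k * y + M i k * M j k * w).det := by
    intro x y z w
    let X : Matrix m m F := of fun i j => M i j + M i k * y + M i k * M j k * w
    have hX : X.det = 0 := by
      have h : X = M * (1 + replicateCol Unit (Pi.single k (1 : F)) *
          replicateRow Unit (fun j => y + M j k * w)) := by
        rw [Matrix.mul_add, Matrix.mul_one, ← Matrix.mul_assoc]
        ext i j
        simp [X, Matrix.mul_apply, Pi.single_apply]
        ring
      rw [h, det_mul, hdet, zero_mul]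
    have h := det_add_vecMulVec_smul_add_smul_row hX 1 1 k x (-z)
    convert h using 2
    · ext i j
      simp [X, hkk, hskew k j]
      ring
    · congr 1
      ext i j
      simp [X]
      ring
  have drop_y : ∀ y w : F,
      (of fun i j => 1 + M i j + M i k * y + M i k * M j k * w).det =
        (of fun i j => 1 + M i j + M i k * M j k * w).det := by
    intro y w
    let X : Matrix m m F := (of fun i j => M i j + M i k * M j k * w)ᵀ
    have hX : X.det = 0 := by
      have h : X = (M * (1 + replicateCol Unit (Pi.single k (1 : F)) *
          replicateRow Unit (fun j => M j k * w)))ᵀ := by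
        rw [Matrix.mul_add, Matrix.mul_one, ← Matrix.mul_assoc]
        ext i j
        simp [X, Matrix.mul_apply, Pi.single_apply]
        ring
      rw [h, det_transpose, det_mul, hdet, zero_mul]
    have h := det_add_vecMulVec_smul_add_smul_row hX 1 1 k 1 y
    rw [one_mul, ← det_transpose, ← det_transpose (X + _)] at h
    convert h using 2
    · ext i j
      simp [X, hkk]
      ring
    · ext i j
      simp [X]
      ring
  have drop_w : (of fun i j => 1 + M i j + M i k * M j k * w).det =
      (of fun i j => 1 + M i j).det := by
    have h := drop_z 1 0 w w
    have h' : (of fun i j => 1 + M i j + M i k * 0 + M j k * w + M i k * M j k * w) =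
        (of fun i j => 1 + M i j) * (1 + replicateCol Unit (Pi.single k (1 : F)) *
          replicateRow Unit (fun j => M j k * w)) := by
      rw [Matrix.mul_add, Matrix.mul_one, ← Matrix.mul_assoc]
      ext i j
      simp [Matrix.mul_apply, Pi.single_apply]
      ring
    rw [h', det_mul, det_one_add_replicateCol_mul_replicateRow, dotProduct_single_one, hkk,
      zero_mul, add_zero, mul_one, one_mul] at h
    rw [h]
    congr 1
    ext i j
    simp
  rw [drop_z, drop_y, drop_w]

/-- The Cauchy-type determinant behind Schur's Pfaffian is a square. -/
theorem Matrix.exists_det_one_add_schur_eq_sq {K : Type*} [Field K] (H : Submonoid K) {n : ℕ}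
    (y : Fin n → K) (hy : ∀ i j, 1 - y i * y j ≠ 0)
    (hH : ∀ i j, i ≠ j → (y i - y j) / (1 - y i * y j) ∈ H) :
    ∃ P ∈ H, (of fun i j => 1 + (y i - y j) / (1 - y i * y j)).det = P ^ 2 := by
  induction n with
  | zero => exact ⟨1, H.one_mem, by simp⟩
  | succ n ih =>
    obtain ⟨P, hP, hdet⟩ := ih (fun i => y i.succ) (fun i j => hy _ _)
      (fun i j hij => hH _ _ (by simpa using hij))
    set G : Matrix (Fin (n + 1)) (Fin (n + 1)) K :=
      of fun i j => 1 + (y i - y j) / (1 - y i * y j) with hG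
    let d : Fin n → K := fun i => (y i.succ - y 0) / (1 - y i.succ * y 0)
    let c : Fin (n + 1) → K := Fin.cons 0 fun i => G i.succ 0
    have h00 : G 0 0 = 1 := by simp [G]
    have h1 : G.det = (of fun i j => G i j - c i * G 0 j).det :=
      det_eq_of_forall_row_eq_smul_add_const c 0 (by simp [c]) (by simp [c])
    refine ⟨(∏ i, d i) * P, H.mul_mem (H.prod_mem fun i _ => hH _ _ (Fin.succ_ne_zero i)) hP, ?_⟩
    have h2 : (of fun i j => G i j - c i * G 0 j).submatrix Fin.succ Fin.succ =
        of fun i j => d i * (of fun i j => d j *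
          (of fun i j : Fin n => 1 + (y i.succ - y j.succ) / (1 - y i.succ * y j.succ)) i j) i j := by
      ext i j
      have := hy i.succ j.succ
      have := hy i.succ 0
      have := hy 0 j.succ
      have h' := hy j.succ 0
      simp only [submatrix_apply, of_apply, c, Fin.cons_succ, G, d]
      field_simp
      ring
    have h3 := congrArg det h2
    rw [det_mul_column, det_mul_row, hdet] at h3
    rw [h1, det_succ_column_zero, Fin.sum_univ_succ, Finset.sum_eq_zero, Fin.succAbove_zero, h3]
    · simp [c, h00]
      ring
    · intro i _
      simp [c, h00]

/-- Barycentric Lagrange interpolation of the monomials of degree less than the number of nodes. -/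
theorem Lagrange.pow_eq_prod_mul_sum {K : Type*} [Field K] {n : ℕ} {x : Fin n → K}
    (hx : Function.Injective x) {z : K} (hz : ∀ r, z ≠ x r) {i : ℕ} (hi : i < n) :
    z ^ i = (∏ s, (z - x s)) *
      ∑ r, nodalWeight Finset.univ x r * (z - x r)⁻¹ * x r ^ i := by
  have h := eval_interpolate_not_at_node (s := Finset.univ) (v := x) (fun r => x r ^ i)
    (fun r _ => hz r)
  rw [eval_nodal] at h
  rw [← h, ← eq_interpolate_of_eval_eq (f := Polynomial.X ^ i) (fun r => x r ^ i) hx.injOn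
    (by simpa using hi) (by simp)]
  simp

/-- Let `x r = y r ^ 2` be nodes whose Lagrange weights have the indicated shape. Then the
difference of the two products of the Vandermonde matrices of `x` and `x⁻¹`, suitably shifted by a
constant, is congruent to the matrix `1 + (y r - y s) / (1 - y r * y s)`. -/
theorem vandermonde_sub_add_eq_mul_mul {K : Type*} [Field K] {n : ℕ} {y : Fin n → K} {c : K}
    (hinj : Function.Injective fun r => y r ^ 2) (h0 : ∀ r, y r ≠ 0) (h1 : ∀ r, y r ^ 2 ≠ 1)
    (hy : ∀ r s, y r ^ 2 * y s ^ 2 ≠ 1) (F : Fin n → K)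
    (hF : ∀ r, F r = ∏ s, ((y r ^ 2)⁻¹ - y s ^ 2))
    (hw : ∀ r, Lagrange.nodalWeight Finset.univ (fun r => y r ^ 2) r =
      c * F r * y r * (1 - y r ^ 2)) (f : K) (hf : f = ∏ s, (1 - y s ^ 2)) (hc : c ≠ 0)
    (B : Matrix (Fin n) (Fin n) K)
    (hB : B = of fun i r : Fin n => (y r ^ 2) ^ (i : ℕ) * (F r * y r)) :
    (of fun i j : Fin n => (c * f ^ 2)⁻¹ +
      ∑ s, ((y s ^ 2) ^ (i : ℕ) * (y s ^ 2)⁻¹ ^ (j : ℕ) -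
        (y s ^ 2)⁻¹ ^ (i : ℕ) * (y s ^ 2) ^ (j : ℕ))) =
      c • (B * (of fun r s => 1 + (y r - y s) / (1 - y r * y s)) * Bᵀ) := by
  have hf0 : f ≠ 0 := by
    rw [hf, Finset.prod_ne_zero_iff]
    exact fun s _ => sub_ne_zero.mpr (h1 s).symm
  have hsub : ∀ r s, 1 - y r ^ 2 * y s ^ 2 ≠ 0 := fun r s => sub_ne_zero.mpr (hy r s).symm
  have hsub' : ∀ r s, 1 - y r * y s ≠ 0 := fun r s h => hsub r s (by
    linear_combination (1 + y r * y s) * h)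
  have hone : ∀ i : Fin n, ∑ r, B i r = (c * f)⁻¹ := by
    intro i
    have h := Lagrange.pow_eq_prod_mul_sum hinj (fun r => (h1 r).symm) i.2
    rw [one_pow, ← hf] at h
    have h2 : ∑ r, Lagrange.nodalWeight Finset.univ (fun r => y r ^ 2) r * (1 - y r ^ 2)⁻¹ *
        (y r ^ 2) ^ (i : ℕ) = c * ∑ r, B i r := by
      rw [Finset.mul_sum]
      refine Finset.sum_congr rfl fun r _ => ?_
      have := sub_ne_zero.mpr (h1 r).symm
      rw [hw, hB, of_apply]
      field_simp
    rw [h2] at h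
    rw [eq_comm, inv_eq_iff_eq_inv, ← eq_comm, inv_eq_iff_eq_inv]
    field_simp
    linear_combination -h
  have hinv : ∀ (s i : Fin n), (y s ^ 2)⁻¹ ^ (i : ℕ) =
      F s * ∑ r, c * F r * y r * (1 - y r ^ 2) * ((y s ^ 2)⁻¹ - y r ^ 2)⁻¹ *
        (y r ^ 2) ^ (i : ℕ) := by
    intro s i
    have h := Lagrange.pow_eq_prod_mul_sum hinj (z := (y s ^ 2)⁻¹) (i := i)
      (fun r h => hy s r (by rw [← h]; exact mul_inv_cancel₀ (pow_ne_zero 2 (h0 s)))) i.2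
    rw [h, hF s]
    simp only [hw]
  ext i j
  have hJ : ∑ r, ∑ s, c * (B i r * B j s) = (c * f ^ 2)⁻¹ := by
    simp_rw [← Finset.mul_sum, hone]
    rw [← Finset.sum_mul, hone]
    field_simp
  have hM : ∑ s, ((y s ^ 2) ^ (i : ℕ) * (y s ^ 2)⁻¹ ^ (j : ℕ) -
        (y s ^ 2)⁻¹ ^ (i : ℕ) * (y s ^ 2) ^ (j : ℕ)) =
      ∑ r, ∑ s, c * (B i r * ((y r - y s) / (1 - y r * y s)) * B j s) := by
    simp_rw [hinv, Finset.sum_sub_distrib, Finset.mul_sum, Finset.sum_mul]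
    rw [Finset.sum_comm (f := fun s r => F s * _ * _), ← Finset.sum_sub_distrib]
    refine Finset.sum_congr rfl fun r _ => ?_
    rw [← Finset.sum_sub_distrib]
    refine Finset.sum_congr rfl fun s _ => ?_
    have a1 := hsub r s
    have a2 := hsub s r
    have a3 := hsub' r s
    have b1 : (y r ^ 2)⁻¹ - y s ^ 2 = (1 - y r ^ 2 * y s ^ 2) / y r ^ 2 := by
      have := h0 r
      field_simp
    have b2 : (y s ^ 2)⁻¹ - y r ^ 2 = (1 - y r ^ 2 * y s ^ 2) / y s ^ 2 := by
      have := h0 s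
      field_simp
    rw [b1, b2, hB, of_apply, of_apply]
    have := h0 r
    have := h0 s
    field_simp
    ring
  rw [of_apply, hM, ← hJ, ← Finset.sum_add_distrib]
  simp only [Matrix.smul_apply, Matrix.mul_apply, transpose_apply, of_apply, smul_eq_mul,
    Finset.mul_sum, Finset.sum_mul]
  rw [Finset.sum_comm]
  simp_rw [← Finset.sum_add_distrib]
  refine Finset.sum_congr rfl fun r _ => Finset.sum_congr rfl fun s _ => ?_
  ring

/-- For a prime `p ≡ 3 (mod 4)`, the residue classes are `0`, the nonzero squares, and their
negatives. -/
theorem ZMod.exists_enum_squares {p n : ℕ} [Fact p.Prime] (hp : p % 4 = 3)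
    (hn : p = 2 * n + 1) :
    ∃ a : Fin n → ZMod p, (∀ i, quadraticChar (ZMod p) (a i) = 1) ∧
      Function.Bijective
        fun o : Option (Fin n ⊕ Fin n) => o.elim 0 (Sum.elim a (-a)) := by
  have hne : ∀ k : ℕ, 0 < k → k < p → (k : ZMod p) ≠ 0 := fun k h0 hk h =>
    absurd (Nat.le_of_dvd h0 ((ZMod.natCast_eq_zero_iff k p).mp h)) (by omega)
  let a : Fin n → ZMod p := fun i => (((i : ℕ) + 1 : ℕ) : ZMod p) ^ 2
  have hb : ∀ i : Fin n, (((i : ℕ) + 1 : ℕ) : ZMod p) ≠ 0 :=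
    fun i => hne _ (by omega) (by omega)
  have h1 : ∀ i, quadraticChar (ZMod p) (a i) = 1 := fun i => quadraticChar_sq_one' (hb i)
  have hneg1 : quadraticChar (ZMod p) (-1) = -1 := by
    rw [quadraticChar_neg_one_iff_not_isSquare, ZMod.exists_sq_eq_neg_one_iff]
    simpa using hp
  have hneg : ∀ i, quadraticChar (ZMod p) (-a i) = -1 := fun i => by
    rw [← neg_one_mul, map_mul, h1, hneg1, mul_one]
  have hinj : Function.Injective a := by
    intro i j h
    rcases sq_eq_sq_iff_eq_or_eq_neg.mp h with h | h
    · rw [ZMod.natCast_eq_natCast_iff', Nat.mod_eq_of_lt (by omega),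
        Nat.mod_eq_of_lt (by omega)] at h
      exact Fin.ext (by omega)
    · rw [eq_neg_iff_add_eq_zero, ← Nat.cast_add] at h
      exact absurd h (hne _ (by omega) (by omega))
  refine ⟨a, h1, (Fintype.bijective_iff_injective_and_card _).mpr ⟨?_, ?_⟩⟩
  · have key : ∀ u v : ZMod p, u = v → quadraticChar (ZMod p) u = quadraticChar (ZMod p) v :=
      fun u v h => by rw [h]
    rintro (_ | i | i) (_ | j | j) h
    · rfl
    · simpa [h1] using key _ _ h
    · simpa [hneg] using key _ _ h
    · simpa [h1] using key _ _ h
    · simpa using hinj h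
    · simpa [h1, hneg] using key _ _ h
    · simpa [hneg] using key _ _ h
    · have := key _ _ h
      simp [h1, hneg] at this
    · simpa using hinj (neg_injective h)
  · simp [ZMod.card]
    omega

theorem ZMod.prod_sub_zmodChar {p : ℕ} [Fact p.Prime] {K : Type*} [Field K] {η : K}
    (hη : IsPrimitiveRoot η p) (r : ZMod p) :
    ∏ b ∈ Finset.univ.erase r,
      (AddChar.zmodChar p hη.pow_eq_one r - AddChar.zmodChar p hη.pow_eq_one b) =
      p * (AddChar.zmodChar p hη.pow_eq_one r)⁻¹ := by
  classical
  set ψ := AddChar.zmodChar p hη.pow_eq_one with hψ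
  have hpos : 0 < p := (Fact.out : p.Prime).pos
  have hinj : Function.Injective ψ := by
    intro a b h
    rw [hψ, AddChar.zmodChar_apply, AddChar.zmodChar_apply] at h
    exact ZMod.val_injective p (hη.pow_inj (ZMod.val_lt a) (ZMod.val_lt b) h)
  have hpow : ∀ a, ψ a ^ p = 1 := fun a => by
    rw [hψ, AddChar.zmodChar_apply, ← pow_mul, mul_comm, pow_mul, hη.pow_eq_one, one_pow]
  have himg : Finset.univ.image ψ = Polynomial.nthRootsFinset p (1 : K) := by
    refine Finset.eq_of_subset_of_card_le ?_ ?_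
    · intro z hz
      obtain ⟨a, -, rfl⟩ := Finset.mem_image.mp hz
      exact (Polynomial.mem_nthRootsFinset hpos 1).mpr (hpow a)
    · rw [hη.card_nthRootsFinset, Finset.card_image_of_injective _ hinj, Finset.card_univ,
        ZMod.card]
  have hnodal : Lagrange.nodal Finset.univ ψ = (Polynomial.X ^ p - 1 : Polynomial K) := by
    rw [Polynomial.X_pow_sub_one_eq_prod hpos hη, ← himg,
      Finset.prod_image fun a _ b _ h => hinj h]
    rfl
  have h := Lagrange.eval_nodal_derivative_eval_node_eq (v := ψ) (Finset.mem_univ r)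
  rw [hnodal, Lagrange.eval_nodal] at h
  rw [← h]
  have h0 : ψ r ≠ 0 := fun h => by simpa [h, hpos.ne'] using hpow r
  have : ψ r ^ (p - 1) = (ψ r)⁻¹ :=
    eq_inv_of_mul_eq_one_left (by rw [← pow_succ, Nat.sub_add_cancel hpos, hpow])
  simp [Polynomial.derivative_X_pow, this]

theorem gaussSum_mul_quadraticChar {p n : ℕ} [Fact p.Prime] (hp : p % 4 = 3) {K : Type*} [Field K]
    [CharZero K] (ψ : AddChar (ZMod p) K)
    {a : Fin n → ZMod p} (ha : ∀ i, quadraticChar (ZMod p) (a i) = 1)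
    (hbij : Function.Bijective
      fun o : Option (Fin n ⊕ Fin n) => o.elim 0 (Sum.elim a (-a)))
    (k : ZMod p) :
    gaussSum ((quadraticChar (ZMod p)).ringHomComp (Int.castRingHom K)) ψ *
      (quadraticChar (ZMod p) k : K) = ∑ s, (ψ (a s * k) - ψ (-(a s * k))) := by
  have hneg1 : quadraticChar (ZMod p) (-1) = -1 := by
    rw [quadraticChar_neg_one_iff_not_isSquare, ZMod.exists_sq_eq_neg_one_iff]
    simpa using hp
  have hneg : ∀ i, quadraticChar (ZMod p) (-a i) = -1 := fun i => by
    rw [← neg_one_mul, map_mul, ha, hneg1, mul_one]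
  set χ := (quadraticChar (ZMod p)).ringHomComp (Int.castRingHom K) with hχ
  have hsum : gaussSum χ (ψ.mulShift k) = ∑ s, (ψ (a s * k) - ψ (-(a s * k))) := by
    rw [gaussSum, ← hbij.sum_comp, Fintype.sum_option, Fintype.sum_sum_type,
      Finset.sum_sub_distrib]
    simp [hχ, ha, hneg, AddChar.mulShift_apply, mul_comm k, sub_eq_add_neg]
  rw [← hsum]
  by_cases hk : k = 0
  · subst hk
    have : gaussSum χ (ψ.mulShift 0) = 0 := by
      rw [hsum]
      simp
    rw [this]
    simp
  · have h := gaussSum_mulShift χ ψ (Units.mk0 k hk)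
    rw [← h, Units.val_mk0]
    have h2 : χ k * χ k = 1 := by
      have := quadraticChar_sq_one hk
      rw [pow_two] at this
      simp only [hχ, MulChar.ringHomComp_apply, eq_intCast]
      exact_mod_cast this
    have h3 : (quadraticChar (ZMod p) k : K) = χ k := by simp [hχ]
    rw [h3, mul_right_comm, h2, one_mul]

theorem nodalWeight_residues {p n : ℕ} [Fact p.Prime] (hp : p % 4 = 3)
    (hn : p = 2 * n + 1) {K : Type*} [Field K]
    [CharZero K] {η : K} (hη : IsPrimitiveRoot η p) {a : Fin n → ZMod p}
    (hbij : Function.Bijective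
      fun o : Option (Fin n ⊕ Fin n) => o.elim 0 (Sum.elim a (-a)))
    {y : Fin n → K} (hy : ∀ r, y r ^ 2 = AddChar.zmodChar p hη.pow_eq_one (a r))
    (hyp : ∀ r, y r ^ p = 1) (r : Fin n) :
    Lagrange.nodalWeight Finset.univ (fun r => y r ^ 2) r =
      (p * ∏ s, y s ^ 2)⁻¹ * (∏ s, ((y r ^ 2)⁻¹ - y s ^ 2)) * y r * (1 - y r ^ 2) := by
  set ψ := AddChar.zmodChar p hη.pow_eq_one with hψ
  have hpp : p.Prime := Fact.out
  have hy0 : ∀ r, y r ≠ 0 := fun r h => by simpa [h, hpp.ne_zero] using hyp r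
  have hp0 : (p : K) ≠ 0 := Nat.cast_ne_zero.mpr hpp.ne_zero
  have ha : ∀ s, a s = a r ↔ s = r := fun s =>
    ⟨fun h => by
      simpa using (hbij.injective h : (some (Sum.inl s) : Option (Fin n ⊕ Fin n)) = some (Sum.inl r)),
      fun h => by rw [h]⟩
  have ha' : ∀ s, -a s ≠ a r := fun s h => by
    simpa using (hbij.injective h : (some (Sum.inr s) : Option (Fin n ⊕ Fin n)) = some (Sum.inl r))
  have ha0 : 0 ≠ a r := fun h => by
    simpa using (hbij.injective h : (none : Option (Fin n ⊕ Fin n)) = some (Sum.inl r))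
  have hprod : (∏ s ∈ Finset.univ.erase r, (y r ^ 2 - y s ^ 2)) *
      ((y r ^ 2 - 1) * ∏ s, (y r ^ 2 - (y s ^ 2)⁻¹)) = p * (y r ^ 2)⁻¹ := by
    have h := ZMod.prod_sub_zmodChar hη (a r)
    rw [← hψ, ← hy] at h
    rw [← h, ← Finset.filter_ne', ← Finset.filter_ne', Finset.prod_filter, Finset.prod_filter,
      ← hbij.prod_comp, Fintype.prod_option, Fintype.prod_sum_type]
    simp only [Option.elim, Sum.elim_inl, Sum.elim_inr, Pi.neg_apply, ne_eq, ha, ha', ha0,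
      not_false_eq_true, if_true, AddChar.map_zero_eq_one, AddChar.map_neg_eq_inv, ← hy]
    ring
  have hflip : ∏ s, ((y r ^ 2)⁻¹ - y s ^ 2) =
      -((∏ s, y s ^ 2) * y r * ∏ s, (y r ^ 2 - (y s ^ 2)⁻¹)) := by
    have h1 : ∀ s, (y r ^ 2)⁻¹ - y s ^ 2 =
        (-(y r ^ 2)⁻¹) * (y s ^ 2 * (y r ^ 2 - (y s ^ 2)⁻¹)) := by
      intro s
      have := hy0 r
      have := hy0 s
      field_simp
      ring
    have h2 : (-(y r ^ 2)⁻¹) ^ n = -y r := by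
      rw [Odd.neg_pow (Nat.odd_iff.mpr (by omega)), inv_pow, ← pow_mul, neg_inj]
      refine inv_eq_of_mul_eq_one_left ?_
      rw [← pow_succ', show 2 * n + 1 = p by omega, hyp]
    simp_rw [h1]
    rw [Finset.prod_mul_distrib, Finset.prod_const, Finset.card_univ, Fintype.card_fin, h2,
      Finset.prod_mul_distrib]
    ring
  have hx0 : ∏ s, y s ^ 2 ≠ 0 := Finset.prod_ne_zero_iff.mpr fun s _ => pow_ne_zero 2 (hy0 s)
  rw [Lagrange.nodalWeight, Finset.prod_inv_distrib, hflip]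
  refine inv_eq_of_mul_eq_one_right ?_
  have hr := hy0 r
  field_simp
  field_simp at hprod
  linear_combination hprod

theorem exists_det_one_add_quadraticChar_eq_sq {p n : ℕ} [Fact p.Prime] (hp : p % 4 = 3)
    (hn : p = 2 * n + 1) :
    ∃ Q : CyclotomicField p ℚ, |Algebra.norm ℚ Q| = 1 ∧
      (of fun i j : Fin n => (1 : CyclotomicField p ℚ) +
        (quadraticChar (ZMod p) ((i : ℕ) - (j : ℕ) : ZMod p) : ℤ)).det = Q ^ 2 := by
  have hpp : p.Prime := Fact.out
  have hp2 : p ≠ 2 := by omega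
  have : NeZero p := ⟨hpp.ne_zero⟩
  have : NeZero (p : ℚ) := ⟨Nat.cast_ne_zero.mpr hpp.ne_zero⟩
  let K := CyclotomicField p ℚ
  have : IsCyclotomicExtension {p} ℚ K := CyclotomicField.isCyclotomicExtension p ℚ
  obtain ⟨η, hη⟩ : ∃ η : K, IsPrimitiveRoot η p :=
    ⟨_, IsCyclotomicExtension.zeta_spec p ℚ K⟩
  obtain ⟨a, ha, hbij⟩ := ZMod.exists_enum_squares hp hn
  have hwt := @nodalWeight_residues p n _ hp hn K _ _ η hη a hbij
  obtain ⟨m, hm⟩ : ∃ m, n = 2 * m + 1 := ⟨(n - 1) / 2, by omega⟩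
  set ψ := AddChar.zmodChar p hη.pow_eq_one with hψ
  let ν : K →* ℚ := (absHom : ℚ →*₀ ℚ).toMonoidHom.comp (Algebra.norm ℚ)
  have hν : ∀ z, ν z = |Algebra.norm ℚ z| := fun z => rfl
  have hν_inv : ∀ z, ν z⁻¹ = (ν z)⁻¹ := fun z => by
    rcases eq_or_ne z 0 with rfl | hz
    · simp [hν, Algebra.norm_zero]
    · exact eq_inv_of_mul_eq_one_left (by rw [← map_mul, inv_mul_cancel₀ hz, map_one])
  have hν_pow : ∀ z k, ν (z ^ k) = ν z ^ k := fun z k => map_pow ν z k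
  -- norms of `p`-th roots of unity and of their differences
  have hirr := Polynomial.cyclotomic.irreducible_rat hpp.pos
  have hroot : ∀ t : ZMod p, t ≠ 0 → IsPrimitiveRoot (ψ t) p := by
    intro t ht
    rw [hψ, AddChar.zmodChar_apply]
    refine hη.pow_of_coprime _ ?_
    rw [Nat.coprime_comm, hpp.coprime_iff_not_dvd, ← ZMod.natCast_eq_zero_iff,
      ZMod.natCast_zmod_val]
    exact ht
  have hν1 : ∀ t, ν (ψ t) = 1 := by
    intro t
    by_cases ht : t = 0
    · rw [ht, AddChar.map_zero_eq_one, map_one]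
    · rw [hν, (hroot t ht).norm_eq_one hp2 hirr, abs_one]
  have hνsub : ∀ s t, s ≠ t → ν (ψ s - ψ t) = p := by
    intro s t hst
    have h : ψ s - ψ t = ψ t * (ψ (s - t) - 1) := by
      rw [mul_sub, ← AddChar.map_add_eq_mul, mul_one, add_sub_cancel]
    rw [h, map_mul, hν1, one_mul, hν,
      (hroot _ (sub_ne_zero.mpr hst)).norm_sub_one_of_prime_ne_two' hirr hp2, Nat.abs_cast]
  have hp0 : (p : ℚ) ≠ 0 := Nat.cast_ne_zero.mpr hpp.ne_zero
  have hψinj : ∀ s t, s ≠ t → ψ s ≠ ψ t := fun s t hst h => by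
    have := hνsub s t hst
    rw [h, sub_self, hν, Algebra.norm_zero, abs_zero] at this
    exact hp0 this.symm
  have hνp : ν p = (p : ℚ) ^ (2 * n) := by
    have h : (p : K) = algebraMap ℚ K p := by simp
    rw [hν, h, Algebra.norm_algebraMap, IsCyclotomicExtension.finrank K hirr,
      Nat.totient_prime hpp, abs_pow, Nat.abs_cast,
      show p - 1 = 2 * n by omega]
  -- the residues and their halves
  have ha_inj : ∀ r s, r ≠ s → a r ≠ a s := fun r s hrs h =>
    hrs (by simpa using (hbij.injective h :
      (some (Sum.inl r) : Option (Fin n ⊕ Fin n)) = some (Sum.inl s)))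
  have ha0 : ∀ r, a r ≠ 0 := fun r h => by
    simpa using (hbij.injective h : (some (Sum.inl r) : Option (Fin n ⊕ Fin n)) = none)
  have ha_add : ∀ r s, a r + a s ≠ 0 := fun r s h => by
    simpa using (hbij.injective (eq_neg_of_add_eq_zero_left h) :
      (some (Sum.inl r) : Option (Fin n ⊕ Fin n)) = some (Sum.inr s))
  have htwo : (2 : ZMod p) ≠ 0 := by
    intro h
    have := (ZMod.natCast_eq_zero_iff 2 p).mp (by exact_mod_cast h)
    have := Nat.le_of_dvd (by norm_num) this
    omega
  let y : Fin n → K := fun r => ψ (2⁻¹ * a r)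
  have hy : ∀ r, y r ^ 2 = ψ (a r) := fun r => by
    rw [pow_two, ← AddChar.map_add_eq_mul, ← two_mul, mul_inv_cancel_left₀ htwo]
  have hyp : ∀ r, y r ^ p = 1 := fun r => by
    rw [← AddChar.map_nsmul_eq_pow, nsmul_eq_mul, CharP.cast_eq_zero, zero_mul,
      AddChar.map_zero_eq_one]
  have hy0 : ∀ r, y r ≠ 0 := fun r h => by simpa [h, hpp.ne_zero] using hyp r
  have hy1 : ∀ r, y r ^ 2 ≠ 1 := fun r => by
    rw [hy, ← AddChar.map_zero_eq_one ψ]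
    exact hψinj _ _ (ha0 r)
  have hyy : ∀ r s, y r ^ 2 * y s ^ 2 ≠ 1 := fun r s => by
    rw [hy, hy, ← AddChar.map_add_eq_mul, ← AddChar.map_zero_eq_one ψ]
    exact hψinj _ _ (ha_add r s)
  have hinj : Function.Injective fun r => y r ^ 2 := by
    intro r s h
    by_contra hrs
    simp only [hy] at h
    exact hψinj _ _ (ha_inj r s hrs) h
  set c : K := (p * ∏ s, y s ^ 2)⁻¹ with hc
  have hνx : ν (∏ s, y s ^ 2) = 1 := by
    simp [map_prod, hy, hν1]
  have hνc : ν c = ((p : ℚ) ^ (2 * n))⁻¹ := by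
    rw [hc, hν_inv, map_mul, hνp, hνx, mul_one]
  have hne : ∀ z, ν z ≠ 0 → z ≠ 0 := fun z hz h => hz (by rw [h, hν, Algebra.norm_zero, abs_zero])
  have hc0 : c ≠ 0 := hne _ (by rw [hνc]; positivity)
  set F : Fin n → K := fun r => ∏ s, ((y r ^ 2)⁻¹ - y s ^ 2) with hF
  have hνF : ∀ r, ν (F r) = (p : ℚ) ^ n := by
    intro r
    have h : ∀ s, ν ((y r ^ 2)⁻¹ - y s ^ 2) = p := by
      intro s
      rw [hy, hy, ← AddChar.map_neg_eq_inv]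
      refine hνsub _ _ fun h => ha_add r s ?_
      rw [← h, add_neg_cancel]
    simp [hF, map_prod, h]
  set f : K := ∏ s, (1 - y s ^ 2) with hf
  have hνf : ν f = (p : ℚ) ^ n := by
    have h : ∀ s, ν (1 - y s ^ 2) = p := by
      intro s
      rw [hy, ← AddChar.map_zero_eq_one ψ]
      exact hνsub _ _ (ha0 s).symm
    simp [hf, map_prod, h]
  have hf0 : f ≠ 0 := hne _ (by rw [hνf]; positivity)
  set B : Matrix (Fin n) (Fin n) K :=
    of fun i r : Fin n => (y r ^ 2) ^ (i : ℕ) * (F r * y r) with hB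
  have hνB : ν B.det = (p : ℚ) ^ (n * m + n * n) := by
    have h1 : B.det = (∏ r, F r * y r) * (vandermonde fun r => y r ^ 2).det := by
      rw [← det_transpose (vandermonde _), ← det_mul_row]
      congr 1
      ext i r
      simp [hB, vandermonde_apply, mul_comm]
    have h2 : ∀ r, ν (F r * y r) = (p : ℚ) ^ n := fun r => by
      rw [map_mul, hνF, hν1, mul_one]
    have h3 : ∀ i : Fin n, ∏ j ∈ Finset.Ioi i, ν (y j ^ 2 - y i ^ 2) =
        (p : ℚ) ^ (n - 1 - i) := by
      intro i
      rw [Finset.prod_congr rfl (g := fun _ => (p : ℚ)), Finset.prod_const, Fin.card_Ioi]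
      intro j hj
      rw [hy, hy]
      exact hνsub _ _ (ha_inj _ _ (Finset.mem_Ioi.mp hj).ne')
    have h4 : ∑ i : Fin n, (n - 1 - (i : ℕ)) = n * m := by
      rw [Fin.sum_univ_eq_sum_range fun i => n - 1 - i, Finset.sum_range_reflect fun i => i]
      have := Finset.sum_range_id_mul_two n
      rw [show n - 1 = m * 2 by omega, ← mul_assoc] at this
      exact Nat.eq_of_mul_eq_mul_right two_pos this
    rw [h1, det_vandermonde, map_mul, map_prod, map_prod]
    simp_rw [map_prod, h2, h3]
    rw [Finset.prod_const, Finset.card_univ, Fintype.card_fin, Finset.prod_pow_eq_pow_sum, h4,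
      ← pow_mul, ← pow_add, add_comm]
  -- the Gauss sum
  set χ := (quadraticChar (ZMod p)).ringHomComp (Int.castRingHom K) with hχ
  have hg := gaussSum_mul_quadraticChar hp ψ ha hbij
  rw [← hχ] at hg
  set g := gaussSum χ ψ with hgdef
  have hνg : ν g = (p : ℚ) ^ n := by
    have hchar : ringChar (ZMod p) ≠ 2 := by rwa [ZMod.ringChar_zmod_n]
    have hquad : χ.IsQuadratic := (quadraticChar_isQuadratic (ZMod p)).comp _
    have hne1 : χ ≠ 1 := (MulChar.ringHomComp_ne_one_iff (RingHom.injective_int _)).mpr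
      (quadraticChar_ne_one hchar)
    have h := gaussSum_sq hne1 hquad (AddChar.zmodChar_primitive_of_primitive_root p hη)
    have hneg1 : quadraticChar (ZMod p) (-1) = -1 := by
      rw [quadraticChar_neg_one_iff_not_isSquare, ZMod.exists_sq_eq_neg_one_iff]
      simpa using hp
    rw [← hψ, ← hgdef, ZMod.card, hχ, MulChar.ringHomComp_apply, hneg1] at h
    have hsq : ν g ^ 2 = ((p : ℚ) ^ n) ^ 2 := by
      have hν_neg : ν (-1) = 1 := by
        refine (pow_eq_one_iff_of_nonneg (by rw [hν]; positivity) two_ne_zero).mp ?_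
        rw [← hν_pow, neg_one_sq, map_one]
      rw [← hν_pow, h, ← pow_mul, mul_comm n 2, ← hνp, map_mul]
      simp [hν_neg]
    exact (pow_left_inj₀ (by rw [hν]; positivity) (by positivity) two_ne_zero).mp hsq
  have hg0 : g ≠ 0 := hne _ (by rw [hνg]; positivity)
  -- the Schur matrix
  have hyyne : ∀ r s, 1 - y r * y s ≠ 0 := fun r s h =>
    hyy r s (by linear_combination (-1 - y r * y s) * h)
  obtain ⟨P, hP, hdetP⟩ := exists_det_one_add_schur_eq_sq (MonoidHom.mker ν) y hyyne (by
    intro r s hrs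
    rw [MonoidHom.mem_mker, div_eq_mul_inv, map_mul, hν_inv, hνsub, ← AddChar.map_add_eq_mul,
      ← AddChar.map_zero_eq_one ψ, hνsub, mul_inv_cancel₀ hp0]
    · rw [← mul_add]
      exact (mul_ne_zero (inv_ne_zero htwo) (ha_add r s)).symm
    · exact fun h => ha_inj r s hrs (mul_left_cancel₀ (inv_ne_zero htwo) h))
  have hfac := vandermonde_sub_add_eq_mul_mul (c := c) hinj hy0 hy1 hyy F (fun _ => rfl)
    (hwt hy hyp) f hf hc0 B hB
  let M : Matrix (Fin n) (Fin n) K :=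
    of fun i j => ((quadraticChar (ZMod p) ((i : ℕ) - (j : ℕ) : ZMod p) : ℤ) : K)
  have hMg : ∀ i j, g * M i j = ∑ s, ((y s ^ 2) ^ (i : ℕ) * (y s ^ 2)⁻¹ ^ (j : ℕ) -
        (y s ^ 2)⁻¹ ^ (i : ℕ) * (y s ^ 2) ^ (j : ℕ)) := by
    intro i j
    have hpow : ∀ s (i j : ℕ), ψ (a s * (i - j)) = (y s ^ 2) ^ i * (y s ^ 2)⁻¹ ^ j := by
      intro s i j
      rw [hy, ← AddChar.map_neg_eq_inv, ← AddChar.map_nsmul_eq_pow, ← AddChar.map_nsmul_eq_pow,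
        ← AddChar.map_add_eq_mul]
      congr 1
      simp only [nsmul_eq_mul]
      ring
    have hM : M i j = ((quadraticChar (ZMod p) ((i : ℕ) - (j : ℕ) : ZMod p) : ℤ) : K) := rfl
    rw [hM, hg]
    refine Finset.sum_congr rfl fun s _ => ?_
    rw [hpow, ← mul_neg, neg_sub, hpow, mul_comm ((y s ^ 2) ^ (j : ℕ))]
  have hMskew : Mᵀ = -M := by
    ext i j
    refine mul_left_cancel₀ hg0 ?_
    rw [transpose_apply, Matrix.neg_apply, mul_neg, hMg, hMg, ← Finset.sum_neg_distrib]
    refine Finset.sum_congr rfl fun s _ => ?_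
    ring
  have hdet := det_skew_add_perturbation hMskew (by rw [Fintype.card_fin, hm]; exact ⟨m, rfl⟩)
    ⟨0, by omega⟩ (g * (c * f ^ 2))⁻¹ 0 0 0
  have hmat : (of fun i j => (g * (c * f ^ 2))⁻¹ + M i j + M i ⟨0, by omega⟩ * 0 +
      M j ⟨0, by omega⟩ * 0 + M i ⟨0, by omega⟩ * M j ⟨0, by omega⟩ * 0) =
      (g⁻¹ * c) • (B * (of fun r s => 1 + (y r - y s) / (1 - y r * y s)) * Bᵀ) := by
    rw [mul_smul, ← hfac]
    ext i j
    rw [Matrix.smul_apply, of_apply, of_apply, ← hMg, smul_eq_mul]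
    simp only [mul_zero, add_zero]
    rw [mul_add, inv_mul_cancel_left₀ hg0, mul_inv]
  rw [hmat, det_smul, det_mul, det_mul, det_transpose, hdetP, Fintype.card_fin] at hdet
  refine ⟨c * f * (g⁻¹ * c) ^ m * B.det * P, ?_, ?_⟩
  · rw [← hν]
    simp only [map_mul, map_pow, hν_inv, hνc, hνf, hνg, hνB, MonoidHom.mem_mker.mp hP]
    rw [show n * n = 2 * (n * m) + n by nth_rw 2 [hm]; ring]
    simp only [mul_pow, inv_pow, ← pow_mul, mul_one]
    field_simp
    ring
  · have h : (of fun i j : Fin n => (1 : K) +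
        (quadraticChar (ZMod p) ((i : ℕ) - (j : ℕ) : ZMod p) : ℤ)).det =
        (of fun i j => 1 + M i j).det := rfl
    rw [h]
    have h2 : (of fun i j => 1 + M i j).det = g * (c * f ^ 2) *
        ((g⁻¹ * c) ^ n * (B.det * P ^ 2 * B.det)) := by
      rw [hdet, mul_inv_cancel_left₀]
      exact mul_ne_zero hg0 (mul_ne_zero hc0 (pow_ne_zero 2 hf0))
    have hpow : (g⁻¹ * c) ^ n = (g⁻¹ * c) * ((g⁻¹ * c) ^ m) ^ 2 := by
      rw [hm]
      ring
    rw [h2, hpow]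
    linear_combination (c ^ 2 * f ^ 2 * ((g⁻¹ * c) ^ m) ^ 2 * B.det ^ 2 * P ^ 2) *
      mul_inv_cancel₀ hg0

theorem det_one_add_quadraticChar {p n : ℕ} [Fact p.Prime] (hp : p % 4 = 3)
    (hn : p = 2 * n + 1) :
    (of fun i j : Fin n => (1 : ℚ) +
      (quadraticChar (ZMod p) ((i : ℕ) - (j : ℕ) : ZMod p) : ℤ)).det = 1 := by
  have hpp : p.Prime := Fact.out
  have : NeZero p := ⟨hpp.ne_zero⟩
  have : NeZero (p : ℚ) := ⟨Nat.cast_ne_zero.mpr hpp.ne_zero⟩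
  let K := CyclotomicField p ℚ
  have : IsCyclotomicExtension {p} ℚ K := CyclotomicField.isCyclotomicExtension p ℚ
  obtain ⟨Q, hQ, hdet⟩ := exists_det_one_add_quadraticChar_eq_sq hp hn
  set D := (of fun i j : Fin n => (1 : ℚ) +
      (quadraticChar (ZMod p) ((i : ℕ) - (j : ℕ) : ZMod p) : ℤ)).det with hD
  have hDQ : algebraMap ℚ K D = Q ^ 2 := by
    rw [← hdet, hD, RingHom.map_det]
    congr 1
    ext i j
    simp
  have hnorm : |D| = 1 := by
    have h := congrArg (fun z => |Algebra.norm ℚ z|) hDQ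
    simp only [map_pow, Algebra.norm_algebraMap, abs_pow, hQ, one_pow] at h
    exact (pow_eq_one_iff_of_nonneg (abs_nonneg D) Module.finrank_pos.ne').mp h
  rcases eq_or_eq_neg_of_abs_eq hnorm with h | h
  · exact h
  · exfalso
    rw [h, map_neg, map_one] at hDQ
    have hodd : Odd p := hpp.odd_of_ne_two (by omega)
    have hη := IsCyclotomicExtension.zeta_spec p ℚ K
    obtain ⟨r, hr⟩ := hη.exists_neg_pow_of_isOfFinOrder hodd (x := Q)
      (isOfFinOrder_iff_pow_eq_one.mpr ⟨4, by norm_num, by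
        rw [show (4 : ℕ) = 2 * 2 by rfl, pow_mul, ← hDQ]; norm_num⟩)
    have h1 : Q ^ (2 * p) = 1 := by
      rw [hr, ← pow_mul, show r * (2 * p) = p * 2 * r by ring, pow_mul, pow_mul,
        hodd.neg_pow, hη.pow_eq_one]
      norm_num
    rw [pow_mul, ← hDQ, hodd.neg_one_pow] at h1
    norm_num at h1

/-- Let `p` be a prime with `p ≡ 3 (mod 4)`. Then for all rationals `x, y, z, w`,
`det [x + ((i-j)/p) + (i/p)y + (j/p)z + (ij/p)w]_{0 ≤ i,j ≤ (p-3)/2} = x`. -/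
theorem stmt0 (p : ℕ) [Fact p.Prime] (hp : p % 4 = 3) (x y z w : ℚ) :
    (Matrix.of fun i j : Fin ((p - 1) / 2) =>
        x + (legendreSym p (((i : ℕ) : ℤ) - ((j : ℕ) : ℤ)) : ℚ)
          + (legendreSym p ((i : ℕ) : ℤ) : ℚ) * y
          + (legendreSym p ((j : ℕ) : ℤ) : ℚ) * z
          + (legendreSym p (((i : ℕ) : ℤ) * ((j : ℕ) : ℤ)) : ℚ) * w).det = x := by
  have hneg1 : quadraticChar (ZMod p) (-1) = -1 := by
    rw [quadraticChar_neg_one_iff_not_isSquare, ZMod.exists_sq_eq_neg_one_iff]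
    simpa using hp
  let M : Matrix (Fin ((p - 1) / 2)) (Fin ((p - 1) / 2)) ℚ :=
    of fun i j => ((quadraticChar (ZMod p) ((i : ℕ) - (j : ℕ) : ZMod p) : ℤ) : ℚ)
  have hM : Mᵀ = -M := by
    ext i j
    simp only [M, transpose_apply, Matrix.neg_apply, of_apply]
    rw [← neg_sub, ← neg_one_mul, map_mul, hneg1]
    simp
  have h := det_skew_add_perturbation hM (by rw [Fintype.card_fin, Nat.odd_iff]; omega)
    ⟨0, by omega⟩ x y z w
  have h1 : (of fun i j => 1 + M i j).det = 1 :=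
    det_one_add_quadraticChar hp (by omega)
  rw [h1, mul_one] at h
  refine Eq.trans (congrArg det ?_) h
  ext i j
  simp [M, legendreSym, -quadraticChar_apply]
end

section
/- Let p be an odd prime with p ≡ 3 (mod 4). Then for all rational numbers x, the determinant of the (p-1)/2 × (p-1)/2 matrix [x + ((i-j)/p)]_{1 ≤ i,j ≤ (p-1)/2} equals x. -/
section

open Finset Matrix Polynomial

/-- Change of points in a Vandermonde matrix by Lagrange interpolation. -/
theorem vandermonde_eq_lagrange_mul {K : Type*} [Field K] {n : ℕ} {y : Fin n → K}
    (hy : Function.Injective y) (x : Fin n → K) :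
    vandermonde x = (of fun s r => (Lagrange.basis univ y r).eval (x s)) * vandermonde y := by
  ext s i
  have h := Lagrange.eq_interpolate (s := univ) (v := y) (f := (X : K[X]) ^ (i : ℕ)) hy.injOn
    (by rw [degree_X_pow, card_univ, Fintype.card_fin]; exact_mod_cast i.2)
  have h' := congrArg (eval (x s)) h
  simp only [Lagrange.interpolate_apply, eval_finsetSum, eval_mul, eval_C, eval_pow, eval_X] at h'
  simp only [vandermonde_apply, mul_apply, of_apply, h']
  exact Finset.sum_congr rfl fun _ _ => mul_comm _ _

theorem prod_nodalWeight {K : Type*} [Field K] {n : ℕ} (y : Fin n → K) :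
    ∏ r, Lagrange.nodalWeight univ y r = (∏ i, ∏ j ∈ {i}ᶜ, (y i - y j))⁻¹ := by
  rw [← prod_inv_distrib]
  refine prod_congr rfl fun i _ => ?_
  rw [Lagrange.nodalWeight, prod_inv_distrib, compl_eq_univ_sdiff, sdiff_singleton_eq_erase]

theorem prod_sub_offDiag_eq {K : Type*} [Field K] {n : ℕ} (y : Fin n → K) :
    ∏ i, ∏ j ∈ {i}ᶜ, (y i - y j) =
      (∏ i, ∏ j ∈ Ioi i, (y i - y j)) * (vandermonde y).det := by
  rw [← prod_prod_Ioi_mul_eq_prod_prod_off_diag fun i j => y j - y i, det_vandermonde]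
  simp_rw [prod_mul_distrib]

theorem prod_sub_Ioi_sq {K : Type*} [Field K] {n : ℕ} (y : Fin n → K) :
    (∏ i, ∏ j ∈ Ioi i, (y i - y j)) ^ 2 = (vandermonde y).det ^ 2 := by
  simp_rw [det_vandermonde, ← prod_pow]
  exact prod_congr rfl fun i _ => prod_congr rfl fun j _ => by ring

/-- Cauchy's determinant `det (1 - yᵢ yⱼ)⁻¹`, in a division-free form. -/
theorem det_cauchy_mul_prod {K : Type*} [Field K] {n : ℕ} {y : Fin n → K}
    (hy : Function.Injective y) (h0 : ∀ i, y i ≠ 0) (h1 : ∀ i j, 1 - y i * y j ≠ 0) :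
    (of fun i j => (1 - y i * y j)⁻¹).det * ∏ i, ∏ j, (1 - y i * y j) =
      (vandermonde y).det ^ 2 := by
  have hV : (vandermonde y).det ≠ 0 := det_vandermonde_ne_zero_iff.2 hy
  have hE : ∏ i, ∏ j ∈ {i}ᶜ, (y i - y j) ≠ 0 := by
    refine prod_ne_zero_iff.2 fun i _ => prod_ne_zero_iff.2 fun j hj => sub_ne_zero.2 fun h => ?_
    simp [hy h] at hj
  -- the Vandermonde determinant at the inverses
  have hinv : (vandermonde fun i => (y i)⁻¹).det * ∏ i, ∏ j ∈ ({i}ᶜ : Finset (Fin n)), y i =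
      ∏ i, ∏ j ∈ Ioi i, (y i - y j) := by
    rw [← prod_prod_Ioi_mul_eq_prod_prod_off_diag fun i j => y j, det_vandermonde,
      ← prod_mul_distrib]
    refine prod_congr rfl fun i _ => ?_
    rw [← prod_mul_distrib]
    refine prod_congr rfl fun j _ => ?_
    field_simp [h0 i, h0 j]
  have hM : (of fun s r => (Lagrange.basis univ y r).eval ((y s)⁻¹)) =
      diagonal (fun s => (∏ r, (1 - y s * y r)) * (∏ j ∈ ({s}ᶜ : Finset (Fin n)), y s)⁻¹) *
        (of fun i j => (1 - y i * y j)⁻¹) *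
        diagonal (Lagrange.nodalWeight univ y) := by
    ext s r
    have hne : (y s)⁻¹ ≠ y r := by
      intro h
      exact h1 s r (by rw [← h, mul_inv_cancel₀ (h0 s), sub_self])
    rw [mul_diagonal, diagonal_mul, of_apply, of_apply,
      Lagrange.eval_basis_not_at_node (mem_univ r) hne, Lagrange.eval_nodal]
    have e1 : ∏ i, ((y s)⁻¹ - y i) = (∏ r, (1 - y s * y r)) * (y s ^ n)⁻¹ := by
      have e : y s ^ n = ∏ _i : Fin n, y s := by simp
      rw [e, ← prod_inv_distrib, ← prod_mul_distrib]
      refine prod_congr rfl fun i _ => ?_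
      field_simp [h0 s]
    have e2 : ((y s)⁻¹ - y r)⁻¹ = y s * (1 - y s * y r)⁻¹ := by
      have := h0 s
      have := h1 s r
      rw [show (y s)⁻¹ - y r = (y s)⁻¹ * (1 - y s * y r) by field_simp, mul_inv, inv_inv]
    have e3 : y s ^ n = y s * ∏ j ∈ ({s}ᶜ : Finset (Fin n)), y s := by
      rw [compl_eq_univ_sdiff, sdiff_singleton_eq_erase,
        mul_prod_erase univ (fun _ => y s) (mem_univ s)]
      simp
    have e4 : ∏ j ∈ ({s}ᶜ : Finset (Fin n)), y s ≠ 0 := prod_ne_zero_iff.2 fun _ _ => h0 s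
    rw [e1, e2, e3]
    have := h0 s
    field_simp
  have key := congrArg det (vandermonde_eq_lagrange_mul hy fun s => (y s)⁻¹)
  rw [det_mul, hM, det_mul, det_mul, det_diagonal, det_diagonal, prod_nodalWeight,
    prod_mul_distrib, prod_inv_distrib] at key
  have hT : ∏ i, ∏ j ∈ ({i}ᶜ : Finset (Fin n)), y i ≠ 0 :=
    prod_ne_zero_iff.2 fun i _ => prod_ne_zero_iff.2 fun _ _ => h0 i
  rw [prod_sub_offDiag_eq] at key hE
  have hsq := prod_sub_Ioi_sq y
  rw [← hinv] at key hE hsq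
  have hW := left_ne_zero_of_mul (left_ne_zero_of_mul hE)
  generalize (of fun i j => (1 - y i * y j)⁻¹).det = c at *
  generalize (vandermonde fun s => (y s)⁻¹).det = v at *
  field_simp at key
  rw [← hsq]
  linear_combination -key

theorem det_vandermonde_sq {K : Type*} [Field K] {n : ℕ} (y : Fin n → K) :
    (vandermonde fun i => y i ^ 2).det ^ 2 =
      (vandermonde y).det ^ 2 * ∏ i, ∏ j ∈ {i}ᶜ, (y i + y j) := by
  rw [← prod_prod_Ioi_mul_eq_prod_prod_off_diag fun i j => y j + y i, det_vandermonde,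
    det_vandermonde]
  simp_rw [← prod_pow, ← prod_mul_distrib]
  exact prod_congr rfl fun i _ => prod_congr rfl fun j _ => by ring

theorem prod_sub_offDiag_sq {K : Type*} [Field K] {n : ℕ} (y : Fin n → K) :
    (∏ i, ∏ j ∈ {i}ᶜ, (y i - y j)) ^ 2 = (vandermonde y).det ^ 4 := by
  rw [prod_sub_offDiag_eq, mul_pow, prod_sub_Ioi_sq]
  ring

/-- The matrix factors as `Uᵀ * D₁ * C * D₂ * U` with `U` a Vandermonde matrix, `C` a Cauchy matrix
and `D₁`, `D₂` diagonal. -/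
theorem det_toeplitz_sub_one {K : Type*} [Field K] {n : ℕ} (hn : Odd n) (y : Fin n → K) {P q : K}
    (hz : Function.Injective fun i => y i ^ 2) (h0 : ∀ i, y i ≠ 0)
    (h1 : ∀ i, y i ^ 2 ≠ 1) (h2 : ∀ i j, y i ^ 2 * y j ^ 2 ≠ 1) (hq0 : q ≠ 0) (hP : q ^ 2 = -P)
    (hq : ∏ i, (1 - y i ^ 2) = q)
    (hrel : ∀ a, (∏ b, ((y a ^ 2)⁻¹ - y b ^ 2)) * (∏ b ∈ {a}ᶜ, (y a ^ 2 - y b ^ 2)) *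
      (y a ^ 2 - 1) = -P * (y a ^ 2)⁻¹ * y a)
    (hadd : ∏ i, ∏ j ∈ {i}ᶜ, (y i + y j) = 1)
    (hmul : ∏ i, ∏ j ∈ {i}ᶜ, (1 - y i * y j) = q ^ (n - 1)) :
    (of fun i j : Fin n => ∑ r, ((y r ^ 2) ^ (i : ℕ) * ((y r ^ 2)⁻¹) ^ (j : ℕ) -
      ((y r ^ 2)⁻¹) ^ (i : ℕ) * (y r ^ 2) ^ (j : ℕ)) - 1).det = -q ^ (n - 1) := by
  set z : Fin n → K := fun i => y i ^ 2 with hzdef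
  set v := Lagrange.nodalWeight univ z with hv
  set c : Fin n → K := fun r => v r * (z r - 1)⁻¹ with hc
  have hy : Function.Injective y := fun i j h => hz (by simp [hzdef, h])
  have hsub : ∀ i j, 1 - y i * y j ≠ 0 := fun i j h => h2 i j (by
    linear_combination (-1 - y i * y j) * h)
  have hadd' : ∀ i j, 1 + y i * y j ≠ 0 := fun i j h => h2 i j (by
    linear_combination (-1 + y i * y j) * h)
  have hz0 : ∀ i, z i ≠ 0 := fun i => pow_ne_zero 2 (h0 i)
  have hz1 : ∀ i, z i - 1 ≠ 0 := fun i => sub_ne_zero.2 (h1 i)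
  have hv0 : ∀ i, v i ≠ 0 := fun i => Lagrange.nodalWeight_ne_zero hz.injOn (mem_univ i)
  have hu : ∀ a, (∏ b, ((z a)⁻¹ - z b)) = -P * (z a)⁻¹ * y a * c a := by
    intro a
    have hva : v a = (∏ b ∈ {a}ᶜ, (z a - z b))⁻¹ := by
      rw [hv, Lagrange.nodalWeight, prod_inv_distrib, compl_eq_univ_sdiff,
        sdiff_singleton_eq_erase]
    have h := hrel a
    rw [← inv_inv (∏ b ∈ {a}ᶜ, (y a ^ 2 - y b ^ 2))] at h
    change _ * (∏ b ∈ {a}ᶜ, (z a - z b))⁻¹⁻¹ * (z a - 1) = -P * (z a)⁻¹ * y a at h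
    rw [← hva] at h
    rw [← h, hc]
    have := hv0 a
    have := hz1 a
    field_simp
    rfl
  have hM : ∀ r s, (Lagrange.basis univ z s).eval (z r)⁻¹ =
      -P * y r * c r * c s * (z s - 1) * (1 - z r * z s)⁻¹ := by
    intro r s
    have hne : (z r)⁻¹ ≠ z s := fun h => h2 r s (by
      change z r * z s = 1
      rw [← h, mul_inv_cancel₀ (hz0 r)])
    have e : ((z r)⁻¹ - z s)⁻¹ = z r * (1 - z r * z s)⁻¹ := by
      have := hz0 r
      rw [show (z r)⁻¹ - z s = (z r)⁻¹ * (1 - z r * z s) by field_simp, mul_inv, inv_inv]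
    have e' : v s = c s * (z s - 1) := by
      rw [hc]
      exact (inv_mul_cancel_right₀ (hz1 s) _).symm
    rw [Lagrange.eval_basis_not_at_node (mem_univ s) hne, Lagrange.eval_nodal, hu, e, ← hv, e']
    have := hz0 r
    field_simp
  have hl : ∀ r, (Lagrange.basis univ z r).eval 1 = -q * c r := by
    intro r
    rw [Lagrange.eval_basis_not_at_node (mem_univ r) (h1 r).symm, Lagrange.eval_nodal, hq, ← hv, hc,
      ← neg_sub (z r) 1, inv_neg]
    ring
  set U := vandermonde z with hU
  set C : Matrix (Fin n) (Fin n) K := of fun i j => (1 - y i * y j)⁻¹ with hC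
  have hfac : (of fun i j : Fin n => ∑ r, ((y r ^ 2) ^ (i : ℕ) * ((y r ^ 2)⁻¹) ^ (j : ℕ) -
      ((y r ^ 2)⁻¹) ^ (i : ℕ) * (y r ^ 2) ^ (j : ℕ)) - 1) =
      Uᵀ * (diagonal (fun r => P * c r * (1 + y r)) * C * diagonal fun s => c s * (1 - y s)) *
        U := by
    set M : Matrix (Fin n) (Fin n) K :=
      of fun r s => (Lagrange.basis univ z s).eval (z r)⁻¹ with hMdef
    set L : Matrix (Fin n) (Fin n) K :=
      of fun _ s => (Lagrange.basis univ z s).eval 1 with hL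
    have hUbar : vandermonde (fun r => (z r)⁻¹) = M * U := vandermonde_eq_lagrange_mul hz _
    have hone : vandermonde (fun _ : Fin n => (1 : K)) = L * U := vandermonde_eq_lagrange_mul hz _
    have hmid : diagonal (fun r => P * c r * (1 + y r)) * C * diagonal (fun s => c s * (1 - y s)) =
        M - Mᵀ - of fun r s =>
          (Lagrange.basis univ z r).eval 1 * (Lagrange.basis univ z s).eval 1 := by
      ext r s
      have e : 1 - z r * z s = (1 - y r * y s) * (1 + y r * y s) := by rw [hzdef]; ring
      have := hsub r s
      have := hadd' r s
      rw [mul_diagonal, diagonal_mul]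
      change P * c r * (1 + y r) * (1 - y r * y s)⁻¹ * (c s * (1 - y s)) =
        (Lagrange.basis univ z s).eval (z r)⁻¹ - (Lagrange.basis univ z r).eval (z s)⁻¹ -
          (Lagrange.basis univ z r).eval 1 * (Lagrange.basis univ z s).eval 1
      rw [hM, hM, hl, hl, mul_comm (z s), e, mul_inv]
      rw [show -q * c r * (-q * c s) = -P * (c r * c s) by rw [← hP]; ring, hzdef]
      field_simp
      ring
    have hrank : Uᵀ * (of fun r s =>
        (Lagrange.basis univ z r).eval 1 * (Lagrange.basis univ z s).eval 1) * U = of 1 := by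
      have hrow : ∀ i : Fin n, ∑ r, (Lagrange.basis univ z r).eval 1 * U r i = 1 := by
        intro i
        have := congrFun (congrFun hone i) i
        rw [vandermonde_apply, one_pow, Matrix.mul_apply] at this
        exact this.symm
      ext i j
      have : ∀ s, (Uᵀ * (of fun r s =>
        (Lagrange.basis univ z r).eval 1 * (Lagrange.basis univ z s).eval 1)) i s =
          (Lagrange.basis univ z s).eval 1 := by
        intro s
        rw [Matrix.mul_apply]
        simp only [transpose_apply, of_apply]
        trans (∑ r, (Lagrange.basis univ z r).eval 1 * U r i) * (Lagrange.basis univ z s).eval 1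
        · rw [sum_mul]
          exact sum_congr rfl fun r _ => by ring
        · rw [hrow, one_mul]
      rw [Matrix.mul_apply]
      simp_rw [this]
      rw [hrow]
      rfl
    rw [hmid, Matrix.mul_sub, Matrix.sub_mul, hrank, Matrix.mul_sub, Matrix.sub_mul,
      Matrix.mul_assoc, Matrix.mul_assoc, ← hUbar]
    have : Uᵀ * (Mᵀ * U) = (vandermonde fun r => (z r)⁻¹)ᵀ * U := by
      rw [← Matrix.mul_assoc, ← transpose_mul, ← hUbar]
    rw [this]
    ext i j
    simp only [of_apply, Matrix.sub_apply, Matrix.mul_apply, transpose_apply, hU, vandermonde_apply,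
      sum_sub_distrib, Pi.one_apply]
    rfl
  have hVz : U.det ≠ 0 := det_vandermonde_ne_zero_iff.2 hz
  have hVy : (vandermonde y).det ≠ 0 := det_vandermonde_ne_zero_iff.2 hy
  have hUV : U.det ^ 2 = (vandermonde y).det ^ 2 := by
    rw [hU, hzdef, det_vandermonde_sq, hadd, mul_one]
  have hE := prod_sub_offDiag_sq z
  rw [← hU] at hE
  have hcprod : ∏ r, c r = (∏ i, ∏ j ∈ {i}ᶜ, (z i - z j))⁻¹ * (-q)⁻¹ := by
    rw [hc, prod_mul_distrib, hv, prod_nodalWeight, prod_inv_distrib, ← hq]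
    congr 2
    have e : (-1 : K) ^ n = ∏ _i : Fin n, (-1) := by simp
    rw [← neg_one_mul, ← hn.neg_one_pow, e, ← prod_mul_distrib]
    exact prod_congr rfl fun i _ => by ring
  have hCdet := det_cauchy_mul_prod hy h0 hsub
  have hall : ∏ i, ∏ j, (1 - y i * y j) = q * q ^ (n - 1) := by
    rw [← hmul, ← hq, ← prod_mul_distrib]
    refine prod_congr rfl fun i _ => ?_
    rw [compl_eq_univ_sdiff, sdiff_singleton_eq_erase, sq,
      mul_prod_erase univ (fun j => 1 - y i * y j) (mem_univ i)]
  rw [hall, ← hC, ← hUV] at hCdet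
  have hPn : P ^ n = -(q ^ (n - 1) * q ^ (n - 1) * q ^ 2) := by
    rw [show P = -q ^ 2 by rw [hP, neg_neg], hn.neg_pow, ← pow_mul, ← pow_add, ← pow_add]
    congr 2
    have := hn.pos
    omega
  have hyy : (∏ r, (1 + y r)) * ∏ r, (1 - y r) = q := by
    rw [← hq, ← prod_mul_distrib]
    exact prod_congr rfl fun i _ => by ring
  clear_value c v
  rw [hfac, det_mul, det_mul, det_mul, det_mul, det_transpose, det_diagonal, det_diagonal,
    prod_mul_distrib, prod_mul_distrib, prod_mul_distrib, prod_const, card_univ, Fintype.card_fin,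
    hPn, hcprod]
  have hE0 : ∏ i, ∏ j ∈ {i}ᶜ, (z i - z j) ≠ 0 := by
    intro h
    rw [h] at hE
    exact hVz (by simpa using hE.symm)
  generalize ∏ i, ∏ j ∈ {i}ᶜ, (z i - z j) = E at *
  have hqn : q ^ (n - 1) ≠ 0 := pow_ne_zero _ hq0
  generalize q ^ (n - 1) = t at *
  have hCC : C.det = U.det ^ 2 * (q * t)⁻¹ := by
    rw [← hCdet, mul_inv_cancel_right₀ (mul_ne_zero hq0 hqn)]
  rw [hCC]
  generalize U.det = u at *
  generalize (∏ r, (1 + y r)) = A at *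
  generalize (∏ r, (1 - y r)) = B at *
  field_simp
  rw [hE, ← hyy]
  ring

/-- The nonzero quadratic residues modulo `p`. -/
def quadraticResidues (p : ℕ) [Fact p.Prime] : Finset (ZMod p) :=
  univ.filter fun a => quadraticChar (ZMod p) a = 1

section residues

variable {p : ℕ} [Fact p.Prime]

theorem two_ne_zero_of_mod_four (hp : p % 4 = 3) : (2 : ZMod p) ≠ 0 := by
  intro h
  have : p ∣ 2 := (ZMod.natCast_eq_zero_iff 2 p).1 (by exact_mod_cast h)
  have := Nat.le_of_dvd two_pos this
  omega

theorem mem_quadraticResidues {a : ZMod p} :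
    a ∈ quadraticResidues p ↔ quadraticChar (ZMod p) a = 1 := by
  simp [quadraticResidues]

theorem ne_zero_of_mem_quadraticResidues {a : ZMod p} (ha : a ∈ quadraticResidues p) : a ≠ 0 := by
  rintro rfl
  simp [mem_quadraticResidues] at ha

theorem one_mem_quadraticResidues : (1 : ZMod p) ∈ quadraticResidues p := by
  simp [mem_quadraticResidues]

theorem quadraticChar_inv_eq (a : ZMod p) :
    quadraticChar (ZMod p) a⁻¹ = quadraticChar (ZMod p) a := by
  rcases eq_or_ne a 0 with rfl | ha
  · simp
  · have h : quadraticChar (ZMod p) a⁻¹ * quadraticChar (ZMod p) a = 1 := by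
      rw [← map_mul, inv_mul_cancel₀ ha, map_one]
    rcases quadraticChar_dichotomy ha with h' | h' <;> rw [h'] at h ⊢ <;> linarith

theorem quadraticChar_neg_one_of_mod_four (hp : p % 4 = 3) :
    quadraticChar (ZMod p) (-1) = -1 := by
  rw [quadraticChar_neg_one_iff_not_isSquare, ZMod.exists_sq_eq_neg_one_iff]
  simpa using hp

theorem quadraticChar_neg (hp : p % 4 = 3) (a : ZMod p) :
    quadraticChar (ZMod p) (-a) = -quadraticChar (ZMod p) a := by
  rw [← neg_one_mul a, map_mul, quadraticChar_neg_one_of_mod_four hp, neg_one_mul]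

theorem neg_notMem_quadraticResidues (hp : p % 4 = 3) {a : ZMod p}
    (ha : a ∈ quadraticResidues p) : -a ∉ quadraticResidues p := by
  rw [mem_quadraticResidues] at *
  rw [quadraticChar_neg hp, ha]
  norm_num

@[to_additive]
theorem prod_erase_zero_eq {M : Type*} [CommMonoid M] (hp : p % 4 = 3) (f : ZMod p → M) :
    ∏ a ∈ univ.erase 0, f a =
      (∏ a ∈ quadraticResidues p, f a) * ∏ a ∈ quadraticResidues p, f (-a) := by
  rw [← prod_filter_mul_prod_filter_not (univ.erase 0)
    (fun a => quadraticChar (ZMod p) a = 1)]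
  congr 1
  · refine prod_congr ?_ fun _ _ => rfl
    ext a
    simp only [mem_filter, mem_erase, mem_univ, and_true, mem_quadraticResidues,
      and_iff_right_iff_imp]
    exact fun h => ne_zero_of_mem_quadraticResidues (mem_quadraticResidues.2 h)
  · refine prod_nbij' (fun a => -a) (fun a => -a) ?_ ?_ (by simp) (by simp) (by simp)
    · intro a ha
      simp only [mem_filter, mem_erase, mem_univ, and_true] at ha
      rw [mem_quadraticResidues, quadraticChar_neg hp,
        (quadraticChar_eq_neg_one_iff_not_one ha.1).2 ha.2, neg_neg]
    · intro a ha
      simp only [mem_filter, mem_erase, mem_univ, and_true]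
      exact ⟨neg_ne_zero.2 (ne_zero_of_mem_quadraticResidues ha),
        fun h => neg_notMem_quadraticResidues hp ha (mem_quadraticResidues.2 h)⟩

@[to_additive sum_comp_mul_left_of_mem]
theorem prod_comp_mul_left_of_mem {M : Type*} [CommMonoid M] {k : ZMod p}
    (hk : k ∈ quadraticResidues p) (f : ZMod p → M) :
    ∏ a ∈ quadraticResidues p, f (k * a) = ∏ a ∈ quadraticResidues p, f a := by
  have h0 := ne_zero_of_mem_quadraticResidues hk
  rw [mem_quadraticResidues] at hk
  refine prod_nbij' (fun a => k * a) (fun a => k⁻¹ * a) ?_ ?_ ?_ ?_ (by simp)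
  · intro a ha
    rw [mem_quadraticResidues] at *
    rw [map_mul, hk, ha, one_mul]
  · intro a ha
    rw [mem_quadraticResidues] at *
    rw [map_mul, quadraticChar_inv_eq, hk, ha, one_mul]
  · exact fun a _ => inv_mul_cancel_left₀ h0 a
  · exact fun a _ => mul_inv_cancel_left₀ h0 a

theorem card_quadraticResidues (hp : p % 4 = 3) : #(quadraticResidues p) = (p - 1) / 2 := by
  have h := sum_erase_zero_eq hp fun _ => (1 : ℕ)
  simp only [sum_const, smul_eq_mul, mul_one, card_erase_of_mem (mem_univ _), card_univ,
    ZMod.card] at h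
  omega

theorem sum_quadraticResidues (hp : p % 4 = 3) (hp3 : p ≠ 3) :
    ∑ a ∈ quadraticResidues p, a = 0 := by
  have h2 := two_ne_zero_of_mod_four hp
  have h3 : (3 : ZMod p) ≠ 0 := by
    intro h
    have : p ∣ 3 := (ZMod.natCast_eq_zero_iff 3 p).1 (by exact_mod_cast h)
    exact hp3 ((Nat.prime_dvd_prime_iff_eq Fact.out Nat.prime_three).1 this)
  have h4 : (2 ^ 2 : ZMod p) ∈ quadraticResidues p := by
    rw [mem_quadraticResidues, map_pow, quadraticChar_sq_one h2]
  have h := sum_comp_mul_left_of_mem h4 fun a => a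
  rw [← mul_sum] at h
  have : (3 : ZMod p) * ∑ a ∈ quadraticResidues p, a = 0 := by linear_combination h
  exact (mul_eq_zero.1 this).resolve_left h3

/-- The involution `u ↦ u⁻¹` pairs equal values of `χ (1 + u)`. -/
theorem prod_quadraticChar_one_add (hp : p % 4 = 3) :
    ∏ u ∈ (quadraticResidues p).erase 1, quadraticChar (ZMod p) (1 + u) = 1 := by
  refine prod_involution (fun u _ => u⁻¹) ?_ ?_ ?_ (by simp)
  · intro u hu
    have hu' := (mem_erase.1 hu).2
    have h0 := ne_zero_of_mem_quadraticResidues hu'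
    have h1 : 1 + u ≠ 0 := by
      intro h
      rw [eq_neg_of_add_eq_zero_right h] at hu'
      exact neg_notMem_quadraticResidues hp one_mem_quadraticResidues hu'
    have : quadraticChar (ZMod p) (1 + u⁻¹) = quadraticChar (ZMod p) (1 + u) := by
      rw [show 1 + u⁻¹ = u⁻¹ * (1 + u) by field_simp; ring, map_mul, quadraticChar_inv_eq,
        mem_quadraticResidues.1 hu', one_mul]
    rw [this, ← sq, quadraticChar_sq_one h1]
  · intro u hu _ h
    obtain ⟨h1, hu'⟩ := mem_erase.1 hu
    have h0 := ne_zero_of_mem_quadraticResidues hu'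
    have : (u - 1) * (u + 1) = 0 := by
      have : u⁻¹ * u = u * u := by rw [h]
      rw [inv_mul_cancel₀ h0] at this
      linear_combination -this
    rcases mul_eq_zero.1 this with h | h
    · exact h1 (sub_eq_zero.1 h)
    · rw [eq_neg_of_add_eq_zero_left h] at hu'
      exact neg_notMem_quadraticResidues hp one_mem_quadraticResidues hu'
  · intro u hu
    obtain ⟨h1, hu'⟩ := mem_erase.1 hu
    rw [mem_erase, mem_quadraticResidues, quadraticChar_inv_eq]
    exact ⟨fun h => h1 (inv_eq_one.1 h), mem_quadraticResidues.1 hu'⟩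

/-- Reindex the off-diagonal pairs `(a, b)` of residues as `(a, a * u)` with `u ≠ 1`. -/
theorem prod_offDiag_quadraticResidues {M : Type*} [CommMonoid M] (f : ZMod p → ZMod p → M) :
    ∏ a ∈ quadraticResidues p, ∏ b ∈ (quadraticResidues p).erase a, f a b =
      ∏ u ∈ (quadraticResidues p).erase 1, ∏ a ∈ quadraticResidues p, f a (u * a) := by
  rw [prod_comm]
  refine prod_congr rfl fun a ha => ?_
  have h0 := ne_zero_of_mem_quadraticResidues ha
  have ha' := mem_quadraticResidues.1 ha
  refine prod_nbij' (fun b => b * a⁻¹) (fun u => u * a) ?_ ?_ ?_ ?_ ?_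
  · intro b hb
    rw [mem_erase, mem_quadraticResidues] at *
    refine ⟨fun h => hb.1 ?_, by rw [map_mul, quadraticChar_inv_eq, ha', hb.2, one_mul]⟩
    rw [mul_inv_eq_iff_eq_mul₀ h0, one_mul] at h
    exact h
  · intro u hu
    rw [mem_erase, mem_quadraticResidues] at *
    exact ⟨fun h => hu.1 (by simpa [h0] using h), by rw [map_mul, ha', hu.2, one_mul]⟩
  · exact fun b _ => inv_mul_cancel_right₀ h0 b
  · exact fun b _ => mul_inv_cancel_right₀ h0 b
  · exact fun b _ => by rw [inv_mul_cancel_right₀ h0 b]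

end residues

section character

variable {p : ℕ} [Fact p.Prime] {ψ : AddChar (ZMod p) ℂ}

theorem prod_one_sub_addChar (hψ : Function.Injective ψ) :
    ∏ a ∈ univ.erase 0, (1 - ψ a) = p := by
  have hp := (Fact.out : p.Prime).pos
  have hX : Lagrange.nodal univ ψ = (X ^ p - 1 : ℂ[X]) := by
    have h : degree (1 : ℂ[X]) < degree ((X : ℂ[X]) ^ p) := by simp [hp]
    refine Polynomial.eq_of_degree_le_of_eval_index_eq (v := ψ) univ hψ.injOn ?_ ?_ ?_ ?_
    · simp
    · rw [degree_sub_eq_left_of_degree_lt h, Lagrange.degree_nodal, card_univ, ZMod.card,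
        degree_X_pow]
    · rw [Lagrange.nodal_monic, leadingCoeff_sub_of_degree_lt h, monic_X_pow]
    · intro a ha
      rw [Lagrange.eval_nodal_at_node ha]
      simp [← AddChar.map_nsmul_eq_pow]
  have h := Lagrange.eval_nodal_derivative_eval_node_eq (v := ψ) (mem_univ (0 : ZMod p))
  rw [hX, AddChar.map_zero_eq_one, Lagrange.eval_nodal] at h
  rw [← h]
  simp [derivative_X_pow]

theorem addChar_sum_eq_prod {ι : Type*} (s : Finset ι) (f : ι → ZMod p) :
    ψ (∑ i ∈ s, f i) = ∏ i ∈ s, ψ (f i) := by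
  classical
  induction s using Finset.induction_on with
  | empty => simp
  | insert a s ha ih => rw [sum_insert ha, prod_insert ha, AddChar.map_add_eq_mul, ih]

/-- The product of `1 - ψ a` over the quadratic residues `a`. -/
noncomputable def residueProd (ψ : AddChar (ZMod p) ℂ) : ℂ := ∏ a ∈ quadraticResidues p, (1 - ψ a)

theorem prod_addChar_mul (hp : p % 4 = 3) (hp3 : p ≠ 3) (k : ZMod p) :
    ∏ a ∈ quadraticResidues p, ψ (k * a) = 1 := by
  rw [← addChar_sum_eq_prod, ← mul_sum, sum_quadraticResidues hp hp3, mul_zero,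
    AddChar.map_zero_eq_one]

theorem odd_card_quadraticResidues (hp : p % 4 = 3) : Odd #(quadraticResidues p) := by
  rw [card_quadraticResidues hp, Nat.odd_iff]
  omega

theorem even_card_erase_quadraticResidues (hp : p % 4 = 3) {a : ZMod p}
    (ha : a ∈ quadraticResidues p) : Even #((quadraticResidues p).erase a) := by
  rw [card_erase_of_mem ha]
  exact (odd_card_quadraticResidues hp).tsub_odd odd_one

theorem prod_one_sub_addChar_neg (hp : p % 4 = 3) (hp3 : p ≠ 3) :
    ∏ a ∈ quadraticResidues p, (1 - ψ (-a)) = -residueProd ψ := by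
  have h : ∀ a, 1 - ψ (-a) = -1 * ψ (-1 * a) * (1 - ψ a) := by
    intro a
    have : ψ (-a) * ψ a = 1 := by
      rw [← AddChar.map_add_eq_mul, neg_add_cancel, AddChar.map_zero_eq_one]
    rw [neg_one_mul a]
    linear_combination -this
  simp_rw [h, prod_mul_distrib]
  rw [prod_const, prod_addChar_mul hp hp3, (odd_card_quadraticResidues hp).neg_one_pow, residueProd]
  ring

theorem prod_one_sub_addChar_mul (hp : p % 4 = 3) (hp3 : p ≠ 3) {k : ZMod p} (hk : k ≠ 0) :
    ∏ a ∈ quadraticResidues p, (1 - ψ (k * a)) = quadraticChar (ZMod p) k * residueProd ψ := by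
  rcases quadraticChar_dichotomy hk with h | h
  · rw [prod_comp_mul_left_of_mem (mem_quadraticResidues.2 h) fun a => 1 - ψ a, h, residueProd]
    simp
  · have hk' : -k ∈ quadraticResidues p := by
      rw [mem_quadraticResidues, quadraticChar_neg hp, h, neg_neg]
    have := prod_comp_mul_left_of_mem hk' fun a => 1 - ψ (-a)
    simp only [neg_mul, neg_neg] at this
    rw [this, prod_one_sub_addChar_neg hp hp3, h]
    simp

theorem residueProd_sq (hp : p % 4 = 3) (hp3 : p ≠ 3) (hψ : Function.Injective ψ) :
    residueProd ψ ^ 2 = -p := by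
  have h := prod_erase_zero_eq hp fun a => 1 - ψ a
  rw [prod_one_sub_addChar hψ, prod_one_sub_addChar_neg hp hp3, ← residueProd] at h
  linear_combination h

theorem prod_offDiag_one_sub (hp : p % 4 = 3) (hp3 : p ≠ 3) {h : ZMod p} (h0 : h ≠ 0) :
    ∏ a ∈ quadraticResidues p, ∏ b ∈ (quadraticResidues p).erase a, (1 - ψ (h * a) * ψ (h * b)) =
      residueProd ψ ^ ((p - 1) / 2 - 1) := by
  rw [prod_offDiag_quadraticResidues]
  have key : ∀ u ∈ (quadraticResidues p).erase 1,
      ∏ a ∈ quadraticResidues p, (1 - ψ (h * a) * ψ (h * (u * a))) =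
        (quadraticChar (ZMod p) h : ℂ) * residueProd ψ * (quadraticChar (ZMod p) (1 + u) : ℂ) := by
    intro u hu
    have h1 : 1 + u ≠ 0 := by
      intro hu1
      rw [eq_neg_of_add_eq_zero_right hu1] at hu
      exact neg_notMem_quadraticResidues hp one_mem_quadraticResidues (mem_erase.1 hu).2
    rw [mul_right_comm, ← Int.cast_mul, ← map_mul,
      ← prod_one_sub_addChar_mul hp hp3 (mul_ne_zero h0 h1)]
    refine prod_congr rfl fun a _ => ?_
    rw [← AddChar.map_add_eq_mul]
    ring_nf
  rw [prod_congr rfl key, prod_mul_distrib, ← Int.cast_prod, prod_quadraticChar_one_add hp,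
    prod_const, mul_pow]
  obtain ⟨m, hm⟩ := even_card_erase_quadraticResidues hp (one_mem_quadraticResidues (p := p))
  have : (quadraticChar (ZMod p) h : ℂ) ^ (m + m) = 1 := by
    rw [← two_mul, pow_mul, ← Int.cast_pow, quadraticChar_sq_one h0]
    simp
  rw [hm, this, ← hm, card_erase_of_mem one_mem_quadraticResidues, card_quadraticResidues hp]
  simp

theorem prod_offDiag_add (hp : p % 4 = 3) (hp3 : p ≠ 3) (hψ : Function.Injective ψ)
    {h : ZMod p} (h0 : h ≠ 0) :
    ∏ a ∈ quadraticResidues p, ∏ b ∈ (quadraticResidues p).erase a, (ψ (h * a) + ψ (h * b)) =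
      1 := by
  have h2 := two_ne_zero_of_mod_four hp
  have hq : residueProd ψ ≠ 0 := by
    intro hq
    have := residueProd_sq hp hp3 hψ
    rw [hq] at this
    exact (Fact.out : p.Prime).ne_zero (by simpa using this.symm)
  rw [prod_offDiag_quadraticResidues]
  have key : ∀ u ∈ (quadraticResidues p).erase 1,
      ∏ a ∈ quadraticResidues p, (ψ (h * a) + ψ (h * (u * a))) =
        (quadraticChar (ZMod p) 2 : ℂ) := by
    intro u hu
    have h1 : h * (u - 1) ≠ 0 := mul_ne_zero h0 (sub_ne_zero.2 (mem_erase.1 hu).1)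
    have e1 := prod_one_sub_addChar_mul (ψ := ψ) hp hp3 h1
    have e2 := prod_one_sub_addChar_mul (ψ := ψ) hp hp3 (mul_ne_zero h2 h1)
    have hne : (quadraticChar (ZMod p) (h * (u - 1)) : ℂ) * residueProd ψ ≠ 0 := by
      refine mul_ne_zero ?_ hq
      rw [Int.cast_ne_zero]
      exact fun h => h1 (quadraticChar_eq_zero_iff.1 h)
    refine mul_right_cancel₀ hne ?_
    rw [← mul_assoc (quadraticChar (ZMod p) 2 : ℂ), ← Int.cast_mul, ← map_mul, ← e2, ← e1,
      ← prod_mul_distrib]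
    have : ∀ a, (ψ (h * a) + ψ (h * (u * a))) * (1 - ψ (h * (u - 1) * a)) =
        ψ (h * a) * (1 - ψ (2 * (h * (u - 1)) * a)) := by
      intro a
      have i1 : ψ (h * (u * a)) = ψ (h * a) * ψ (h * (u - 1) * a) := by
        rw [← AddChar.map_add_eq_mul]; ring_nf
      have i2 : ψ (2 * (h * (u - 1)) * a) = ψ (h * (u - 1) * a) * ψ (h * (u - 1) * a) := by
        rw [← AddChar.map_add_eq_mul]; ring_nf
      rw [i1, i2]
      ring
    simp_rw [this]
    rw [prod_mul_distrib, prod_addChar_mul hp hp3, one_mul]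
  rw [prod_congr rfl key, prod_const]
  obtain ⟨m, hm⟩ := even_card_erase_quadraticResidues hp (one_mem_quadraticResidues (p := p))
  rw [hm, ← two_mul, pow_mul, ← Int.cast_pow, quadraticChar_sq_one h2]
  simp

theorem prod_sub_erase (hψ : Function.Injective ψ) (a : ZMod p) :
    ∏ c ∈ univ.erase a, (ψ a - ψ c) = p * ψ (-a) := by
  have h : ∏ c ∈ univ.erase a, (ψ a - ψ c) = ∏ d ∈ univ.erase 0, ψ a * (1 - ψ d) := by
    refine prod_nbij' (fun c => c - a) (fun d => d + a) ?_ ?_ (by simp) (by simp) ?_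
    · simp [sub_eq_zero]
    · simp
    · intro c _
      have : ψ c = ψ a * ψ (c - a) := by rw [← AddChar.map_add_eq_mul]; ring_nf
      rw [this]
      ring
  rw [h, prod_mul_distrib, prod_one_sub_addChar hψ, prod_const,
    card_erase_of_mem (mem_univ _), card_univ, ZMod.card, ← AddChar.map_nsmul_eq_pow,
    nsmul_eq_mul, Nat.cast_sub (Fact.out : p.Prime).one_le]
  simp [mul_comm]

/-- The value at `ψ (-a)` of the nodal polynomial of the residues, times its derivative at `ψ a`. -/
theorem prod_neg_mul_prod_erase (hp : p % 4 = 3) (hp3 : p ≠ 3) (hψ : Function.Injective ψ)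
    {h a : ZMod p} (h2 : 2 * h = 1) (ha : a ∈ quadraticResidues p) :
    (∏ b ∈ quadraticResidues p, (ψ (-a) - ψ b)) *
        (∏ b ∈ (quadraticResidues p).erase a, (ψ a - ψ b)) * (ψ a - 1) =
      -p * ψ (-a) * ψ (h * a) := by
  have hn : ((#(quadraticResidues p) : ℕ) : ZMod p) = -h := by
    have e : 2 * #(quadraticResidues p) + 1 = p := by
      rw [card_quadraticResidues hp]; omega
    have e' : (2 : ZMod p) * (#(quadraticResidues p) : ℕ) + 1 = 0 := by
      have := congrArg (Nat.cast : ℕ → ZMod p) e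
      simpa using this
    linear_combination h * e' - (#(quadraticResidues p) : ZMod p) * h2
  have e1 : ∏ b ∈ quadraticResidues p, (ψ (-a) - ψ b) =
      -ψ (h * a) * ∏ b ∈ quadraticResidues p, (ψ a - ψ (-b)) := by
    have : ∀ b, ψ (-a) - ψ b = -1 * ψ (-a) * ψ (1 * b) * (ψ a - ψ (-b)) := by
      intro b
      have i1 : ψ (-a) * ψ a = 1 := by
        rw [← AddChar.map_add_eq_mul, neg_add_cancel, AddChar.map_zero_eq_one]
      have i2 : ψ (-b) * ψ b = 1 := by
        rw [← AddChar.map_add_eq_mul, neg_add_cancel, AddChar.map_zero_eq_one]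
      rw [one_mul b]
      linear_combination ψ b * i1 - ψ (-a) * i2
    simp_rw [this, prod_mul_distrib]
    rw [prod_addChar_mul hp hp3, prod_const, prod_const,
      (odd_card_quadraticResidues hp).neg_one_pow, ← AddChar.map_nsmul_eq_pow, nsmul_eq_mul, hn]
    ring_nf
  have e2 : (ψ a - 1) * ((∏ b ∈ (quadraticResidues p).erase a, (ψ a - ψ b)) *
      ∏ b ∈ quadraticResidues p, (ψ a - ψ (-b))) = p * ψ (-a) := by
    have h0 := ne_zero_of_mem_quadraticResidues ha
    have hs := prod_erase_zero_eq hp fun c => if c = a then 1 else ψ a - ψ c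
    have f1 : ∏ b ∈ quadraticResidues p, (if -b = a then 1 else ψ a - ψ (-b)) =
        ∏ b ∈ quadraticResidues p, (ψ a - ψ (-b)) := by
      refine prod_congr rfl fun b hb => if_neg ?_
      rintro rfl
      exact neg_notMem_quadraticResidues hp hb ha
    have f2 : ∀ s : Finset (ZMod p), a ∈ s → ∏ b ∈ s, (if b = a then 1 else ψ a - ψ b) =
        ∏ b ∈ s.erase a, (ψ a - ψ b) := by
      intro s hs
      rw [← mul_prod_erase s _ hs, if_pos rfl, one_mul]
      exact prod_congr rfl fun b hb => if_neg (mem_erase.1 hb).1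
    rw [f1, f2 _ ha, f2 _ (mem_erase.2 ⟨h0, mem_univ _⟩)] at hs
    rw [← hs, ← prod_sub_erase hψ a, erase_right_comm,
      ← mul_prod_erase (univ.erase a) _ (mem_erase.2 ⟨h0.symm, mem_univ 0⟩),
      AddChar.map_zero_eq_one]
  rw [e1]
  linear_combination -ψ (h * a) * e2

end character

/-- Adding a constant to all entries of a skew-symmetric matrix of odd order changes its determinant
linearly, so one nonzero value determines all of them. -/
theorem det_add_const_eq_self {K : Type*} [Field K] [NeZero (2 : K)] {n : ℕ} (hn : Odd n)
    (S : Matrix (Fin n) (Fin n) K) (hS : Sᵀ = -S) {x₀ : K} (hx₀ : x₀ ≠ 0)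
    (h : (of fun i j => x₀ + S i j).det = x₀) (x : K) : (of fun i j => x + S i j).det = x := by
  have hodd : (of fun i j => -x₀ + S i j).det = -x₀ := by
    have e : (of fun i j => -x₀ + S i j) = -(of fun i j => x₀ + S i j)ᵀ := by
      ext i j
      have := congrFun (congrFun hS i) j
      rw [transpose_apply, Matrix.neg_apply] at this
      simp [this, add_comm]
    rw [e, det_neg, det_transpose, h, Fintype.card_fin, hn.neg_one_pow, neg_one_mul]
  set A : Matrix (Fin n) (Fin n) K := of fun i j => x₀ + S i j with hA
  have hlin : ∀ t, (of fun i j => (x₀ + t) + S i j).det =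
      x₀ * (1 + t * (replicateRow Unit (1 : Fin n → K) * A⁻¹ *
        replicateCol Unit (1 : Fin n → K)) () ()) := by
    intro t
    have e : (of fun i j => (x₀ + t) + S i j) =
        A + replicateCol Unit (fun _ => t) * replicateRow Unit (1 : Fin n → K) := by
      ext i j
      simp [hA, Matrix.mul_apply]
      ring
    have ht : replicateCol Unit (fun _ : Fin n => t) = t • replicateCol Unit (1 : Fin n → K) := by
      ext i j
      simp
    rw [e, det_add_replicateCol_mul_replicateRow (by rw [h]; exact hx₀.isUnit), h, ht,
      det_unique]
    simp [Matrix.mul_smul]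
  have h₂ := hlin (-(2 * x₀))
  rw [show x₀ + -(2 * x₀) = -x₀ by ring, hodd] at h₂
  have h₃ := hlin (x - x₀)
  rw [add_sub_cancel] at h₃
  rw [h₃]
  generalize (replicateRow Unit (1 : Fin n → K) * A⁻¹ * replicateCol Unit (1 : Fin n → K)) () () = k
    at h₂
  have h2 : (2 : K) ≠ 0 := two_ne_zero
  have hk : x₀ * k = 1 := by
    have : 2 * x₀ * (x₀ * k - 1) = 0 := by linear_combination h₂
    exact sub_eq_zero.1 ((mul_eq_zero.1 this).resolve_left (mul_ne_zero h2 hx₀))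
  linear_combination (x - x₀) * hk

section gauss

variable {p : ℕ} [Fact p.Prime] {ψ : AddChar (ZMod p) ℂ}

theorem gaussSum_quadraticChar_sq (hp : p % 4 = 3) (hψ : ψ.IsPrimitive) :
    gaussSum ((quadraticChar (ZMod p)).ringHomComp (Int.castRingHom ℂ)) ψ ^ 2 = -p := by
  have hp2 : ringChar (ZMod p) ≠ 2 := by
    rw [ZMod.ringChar_zmod_n]
    rintro rfl
    omega
  rw [gaussSum_sq ?_ ((quadraticChar_isQuadratic _).comp _) hψ]
  · simp [quadraticChar_neg_one_of_mod_four hp]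
  · intro h
    have := congrArg (fun χ => χ (-1)) h
    simp [quadraticChar_neg_one_of_mod_four hp, MulChar.one_apply] at this
    norm_num at this

theorem sum_addChar_sub_neg (hp : p % 4 = 3) (k : ZMod p) :
    ∑ a ∈ quadraticResidues p, (ψ (a * k) - ψ (-a * k)) =
      quadraticChar (ZMod p) k *
        gaussSum ((quadraticChar (ZMod p)).ringHomComp (Int.castRingHom ℂ)) ψ := by
  have hR : ∑ a ∈ quadraticResidues p, (ψ (a * k) - ψ (-a * k)) =
      ∑ a ∈ univ.erase 0, (quadraticChar (ZMod p) a : ℂ) * ψ (a * k) := by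
    rw [sum_erase_zero_eq hp, ← sum_add_distrib]
    refine sum_congr rfl fun a ha => ?_
    rw [quadraticChar_neg hp, mem_quadraticResidues.1 ha]
    push_cast
    ring
  rcases eq_or_ne k 0 with rfl | hk
  · simp
  · rw [hR, sum_erase _ (by simp)]
    have h := gaussSum_mulShift ((quadraticChar (ZMod p)).ringHomComp (Int.castRingHom ℂ)) ψ
      (Units.mk0 k hk)
    rw [← h]
    have hk2 : (quadraticChar (ZMod p) k : ℂ) ^ 2 = 1 := by
      rw [← Int.cast_pow, quadraticChar_sq_one hk]
      simp
    simp only [Units.val_mk0, MulChar.ringHomComp_apply, eq_intCast]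
    rw [← mul_assoc, ← sq, hk2, one_mul, gaussSum]
    simp [AddChar.mulShift_apply, mul_comm k]

end gauss

section enumeration

variable {p : ℕ} [Fact p.Prime]

@[to_additive]
theorem prod_fin_eq_prod_quadraticResidues {n : ℕ} {M : Type*} [CommMonoid M]
    (e : quadraticResidues p ≃ Fin n) (f : ZMod p → M) :
    ∏ i, f (e.symm i) = ∏ a ∈ quadraticResidues p, f a := by
  rw [e.symm.prod_comp fun a => f a, prod_coe_sort]

theorem prod_compl_eq_prod_erase {n : ℕ} {M : Type*} [CommMonoid M]
    (e : quadraticResidues p ≃ Fin n) (i : Fin n) (f : ZMod p → M) :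
    ∏ j ∈ {i}ᶜ, f (e.symm j) = ∏ a ∈ (quadraticResidues p).erase (e.symm i), f a := by
  refine prod_bij (fun j _ => (e.symm j : ZMod p)) ?_ ?_ ?_ fun _ _ => rfl
  · intro j hj
    simp only [mem_compl, mem_singleton] at hj
    exact mem_erase.2 ⟨fun h => hj (e.symm.injective (Subtype.ext h)), (e.symm j).2⟩
  · exact fun j _ k _ h => e.symm.injective (Subtype.ext h)
  · intro a ha
    obtain ⟨h1, h2⟩ := mem_erase.1 ha
    refine ⟨e ⟨a, h2⟩, ?_, by simp⟩
    simp only [mem_compl, mem_singleton]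
    rintro rfl
    simp at h1

end enumeration

theorem det_quadraticChar_sub {p : ℕ} [Fact p.Prime] (hp : p % 4 = 3) (hp3 : p ≠ 3) :
    ∃ t : ℂ, t ≠ 0 ∧ (of fun i j : Fin ((p - 1) / 2) =>
      t + (quadraticChar (ZMod p) ((i : ℕ) - (j : ℕ)) : ℂ)).det = t := by
  set n := (p - 1) / 2 with hn
  have hodd : Odd n := by rw [Nat.odd_iff]; omega
  let ψ : AddChar (ZMod p) ℂ := ZMod.stdAddChar
  have hψ : Function.Injective ψ := ZMod.injective_stdAddChar
  set τ := gaussSum ((quadraticChar (ZMod p)).ringHomComp (Int.castRingHom ℂ)) ψ with hτ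
  have hτ2 : τ ^ 2 = -p := gaussSum_quadraticChar_sq hp (ZMod.isPrimitive_stdAddChar p)
  have hp0 : (p : ℂ) ≠ 0 := Nat.cast_ne_zero.2 (Fact.out : p.Prime).ne_zero
  have hτ0 : τ ≠ 0 := by
    intro h
    rw [h] at hτ2
    exact hp0 (by simpa using hτ2.symm)
  set q := residueProd ψ with hqdef
  have hq2 : q ^ 2 = -p := residueProd_sq hp hp3 hψ
  have hq0 : q ≠ 0 := by
    intro h
    rw [h] at hq2
    exact hp0 (by simpa using hq2.symm)
  let e : quadraticResidues p ≃ Fin n := equivFinOfCardEq (card_quadraticResidues hp)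
  have h2 := two_ne_zero_of_mod_four hp
  have h20 : (2 : ZMod p)⁻¹ ≠ 0 := inv_ne_zero h2
  let y : Fin n → ℂ := fun i => ψ (2⁻¹ * e.symm i)
  have hy2 : ∀ i, y i ^ 2 = ψ (e.symm i) := by
    intro i
    rw [← AddChar.map_nsmul_eq_pow]
    congr 1
    rw [nsmul_eq_mul, Nat.cast_ofNat, mul_inv_cancel_left₀ h2]
  have hyinv : ∀ i, (y i ^ 2)⁻¹ = ψ (-e.symm i) := by
    intro i
    rw [hy2, AddChar.map_neg_eq_inv]
  have hy0 : ∀ i, y i ≠ 0 := by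
    intro i h
    have := congrArg (fun w => w * ψ (-(2⁻¹ * e.symm i))) h
    simp only [y] at this
    rw [← AddChar.map_add_eq_mul] at this
    simp at this
  have key := det_toeplitz_sub_one (P := p) (q := q) hodd y ?_ hy0 ?_ ?_ hq0 hq2 ?_ ?_ ?_ ?_
  · have hmat : (of fun i j : Fin n => ∑ r, ((y r ^ 2) ^ (i : ℕ) * ((y r ^ 2)⁻¹) ^ (j : ℕ) -
        ((y r ^ 2)⁻¹) ^ (i : ℕ) * (y r ^ 2) ^ (j : ℕ)) - 1) =
        τ • of fun i j : Fin n => -τ⁻¹ + (quadraticChar (ZMod p) ((i : ℕ) - (j : ℕ)) : ℂ) := by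
      ext i j
      have hsum := sum_addChar_sub_neg (ψ := ψ) hp ((i : ℕ) - (j : ℕ) : ZMod p)
      rw [← sum_fin_eq_sum_quadraticResidues e] at hsum
      simp only [Matrix.smul_apply, of_apply, smul_eq_mul]
      rw [mul_add, mul_neg, mul_inv_cancel₀ hτ0, mul_comm τ, hτ, ← hsum, sub_eq_neg_add]
      congr 1
      refine sum_congr rfl fun r _ => ?_
      rw [hyinv, hy2]
      simp_rw [← AddChar.map_nsmul_eq_pow, ← AddChar.map_add_eq_mul, nsmul_eq_mul]
      ring_nf
    rw [hmat, det_smul, Fintype.card_fin] at key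
    refine ⟨-τ⁻¹, neg_ne_zero.2 (inv_ne_zero hτ0), ?_⟩
    obtain ⟨m, hm⟩ := hodd
    have hq : q ^ (n - 1) = τ ^ (2 * m) := by
      rw [hm, Nat.add_sub_cancel, pow_mul, hq2, ← hτ2, ← pow_mul]
    have hτn : τ ^ n = τ ^ (2 * m) * τ := by rw [hm, pow_succ]
    rw [hq, hτn, mul_assoc] at key
    have hdet := mul_left_cancel₀ (pow_ne_zero (2 * m) hτ0) (key.trans (mul_neg_one _).symm)
    rw [← mul_right_inj' hτ0, mul_neg, mul_inv_cancel₀ hτ0]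
    exact hdet
  · intro i j h
    simp only [hy2] at h
    exact e.symm.injective (Subtype.ext (hψ h))
  · intro i h
    rw [hy2, ← AddChar.map_zero_eq_one ψ] at h
    exact ne_zero_of_mem_quadraticResidues (e.symm i).2 (hψ h)
  · intro i j h
    rw [hy2, hy2, ← AddChar.map_add_eq_mul, ← AddChar.map_zero_eq_one ψ] at h
    have := (e.symm i).2
    rw [eq_neg_of_add_eq_zero_left (hψ h)] at this
    exact neg_notMem_quadraticResidues hp (e.symm j).2 this
  · simp_rw [hy2]
    exact prod_fin_eq_prod_quadraticResidues e fun a => 1 - ψ a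
  · intro a
    rw [hyinv]
    simp_rw [hy2]
    rw [prod_fin_eq_prod_quadraticResidues e fun b => ψ (-e.symm a) - ψ b,
      prod_compl_eq_prod_erase e a fun b => ψ (e.symm a) - ψ b]
    exact prod_neg_mul_prod_erase hp hp3 hψ (mul_inv_cancel₀ h2) (e.symm a).2
  · rw [← prod_offDiag_add hp hp3 hψ h20, ← prod_fin_eq_prod_quadraticResidues e]
    exact prod_congr rfl fun i _ => prod_compl_eq_prod_erase e i fun b =>
      ψ (2⁻¹ * e.symm i) + ψ (2⁻¹ * b)
  · rw [hqdef, ← prod_offDiag_one_sub hp hp3 h20, ← prod_fin_eq_prod_quadraticResidues e]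
    exact prod_congr rfl fun i _ => prod_compl_eq_prod_erase e i fun b =>
      1 - ψ (2⁻¹ * e.symm i) * ψ (2⁻¹ * b)

end

/-- Let `p` be an odd prime with `p ≡ 3 (mod 4)`. Then for all rationals `x`,
`det [x + ((i-j)/p)]_{1 ≤ i,j ≤ (p-1)/2} = x`. -/
theorem stmt3 (p : ℕ) [Fact p.Prime] (hp : p % 4 = 3) (x : ℚ) :
    (Matrix.of fun i j : Fin ((p - 1) / 2) =>
        x + (legendreSym p ((((i : ℕ) : ℤ) + 1) - (((j : ℕ) : ℤ) + 1)) : ℚ)).det = x := by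
  rcases eq_or_ne p 3 with rfl | hp3
  · change (Matrix.of fun i j : Fin 1 =>
        x + (legendreSym 3 ((((i : ℕ) : ℤ) + 1) - (((j : ℕ) : ℤ) + 1)) : ℚ)).det = x
    rw [Matrix.det_unique]
    simp
  obtain ⟨t, ht0, ht⟩ := det_quadraticChar_sub hp hp3
  have hodd : Odd ((p - 1) / 2) := by
    rw [Nat.odd_iff]
    omega
  have hskew : (Matrix.of fun i j : Fin ((p - 1) / 2) =>
      (quadraticChar (ZMod p) ((i : ℕ) - (j : ℕ)) : ℂ)).transpose =
      -Matrix.of fun i j : Fin ((p - 1) / 2) =>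
        (quadraticChar (ZMod p) ((i : ℕ) - (j : ℕ)) : ℂ) := by
    ext i j
    rw [Matrix.transpose_apply, Matrix.neg_apply, Matrix.of_apply, Matrix.of_apply,
      ← neg_sub ((i : ℕ) : ZMod p), quadraticChar_neg hp, Int.cast_neg]
  have h := det_add_const_eq_self hodd _ hskew ht0 ht x
  have hcast := RingHom.map_det (algebraMap ℚ ℂ) (Matrix.of fun i j : Fin ((p - 1) / 2) =>
    x + (legendreSym p ((((i : ℕ) : ℤ) + 1) - (((j : ℕ) : ℤ) + 1)) : ℚ))
  refine (algebraMap ℚ ℂ).injective (hcast.trans ?_)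
  rw [eq_ratCast, ← h]
  congr 1
  ext i j
  simp [legendreSym]
end

section
/- Let p be a prime with p ≡ 3 (mod 4). Then for all rational numbers x, y, z, the determinant of the (p-1)/2 × (p-1)/2 matrix [x + ((i-j)/p) + (i/p)y + (j/p)z]_{0 ≤ i,j ≤ (p-3)/2} equals x. -/
section

open Matrix Finset

theorem Lagrange.pow_eq_nodal_mul_sum {K : Type*} [Field K] {n : ℕ} {v : Fin n → K}
    (hv : Function.Injective v) {x : K} (hx : ∀ k, x ≠ v k) (i : Fin n) :
    x ^ (i : ℕ) = (∏ m, (x - v m)) *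
      ∑ k, Lagrange.nodalWeight univ v k * (x - v k)⁻¹ * v k ^ (i : ℕ) := by
  have h := Lagrange.eq_interpolate (s := univ) (v := v)
    (f := (Polynomial.X : Polynomial K) ^ (i : ℕ)) hv.injOn (by rw [Polynomial.degree_X_pow]; simp)
  have h2 := congrArg (Polynomial.eval x) h
  rw [Lagrange.eval_interpolate_not_at_node _ (fun k _ => hx k), Lagrange.eval_nodal] at h2
  simpa using h2

/-- A form of Cauchy's determinant formula. -/
theorem Matrix.det_vandermonde_eq_mul_det_cauchy {K : Type*} [Field K] {n : ℕ} {v x : Fin n → K}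
    (hv : Function.Injective v) (hx : ∀ l k, x l ≠ v k) :
    (vandermonde x).det = (∏ l, ∏ m, (x l - v m)) * (of fun l k => (x l - v k)⁻¹).det *
      (∏ k, Lagrange.nodalWeight univ v k) * (vandermonde v).det := by
  have : vandermonde x = diagonal (fun l => ∏ m, (x l - v m)) * (of fun l k => (x l - v k)⁻¹) *
      diagonal (Lagrange.nodalWeight univ v) * vandermonde v := by
    ext l i
    rw [vandermonde_apply, Lagrange.pow_eq_nodal_mul_sum hv (hx l), Matrix.mul_apply, mul_sum]
    refine sum_congr rfl fun k _ => ?_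
    simp [mul_diagonal, diagonal_mul, vandermonde_apply]
    ring
  rw [this]
  simp [det_mul]

theorem Lagrange.prod_nodalWeight_sq {K : Type*} [Field K] {n : ℕ} (v : Fin n → K) :
    (∏ k, Lagrange.nodalWeight univ v k) ^ 2 = ((vandermonde v).det ^ 4)⁻¹ := by
  have h := prod_prod_Ioi_mul_eq_prod_prod_off_diag (fun j i => (v i - v j)⁻¹)
  have h2 : ∏ k, Lagrange.nodalWeight univ v k = ∏ i, ∏ j ∈ {i}ᶜ, (v i - v j)⁻¹ := by
    refine prod_congr rfl fun k _ => prod_congr ?_ fun _ _ => rfl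
    ext; simp
  rw [h2, ← h, det_vandermonde]
  simp only [← prod_pow, ← prod_inv_distrib]
  refine prod_congr rfl fun i _ => prod_congr rfl fun j _ => ?_
  rw [← neg_sub (v j) (v i), inv_neg, ← inv_pow]
  ring

theorem Finset.prod_prod_eq_prod_diag_mul_prod_Ioi {K : Type*} [CommMonoid K] {n : ℕ}
    (f : Fin n → Fin n → K) (hf : ∀ i j, f i j = f j i) :
    ∏ i, ∏ j, f i j = (∏ i, f i i) * (∏ i, ∏ j ∈ Ioi i, f i j) ^ 2 := by
  have h := prod_prod_Ioi_mul_eq_prod_prod_off_diag f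
  have h2 (i : Fin n) : ∏ j, f i j = f i i * ∏ j ∈ {i}ᶜ, f j i := by
    rw [Fintype.prod_eq_mul_prod_compl i]
    exact congrArg _ (prod_congr rfl fun j _ => hf i j)
  simp_rw [h2, prod_mul_distrib, ← h, ← prod_pow]
  congr 1
  refine prod_congr rfl fun i _ => prod_congr rfl fun j _ => ?_
  rw [hf j i, sq]

theorem Matrix.det_cauchy_self_sq {K : Type*} [Field K] {n : ℕ} {s : Fin n → K}
    (hs : Function.Injective s) (hs0 : ∀ i, s i ≠ 0) (hss : ∀ i j, s i * s j ≠ 1) :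
    (of fun k l => (1 + s k) * (1 - s l) / (1 - s k * s l)).det ^ 2 *
      (∏ i, ∏ j ∈ Ioi i, (1 - s i * s j)) ^ 4 = (vandermonde s).det ^ 4 := by
  set D := (of fun l k => (1 - s l * s k)⁻¹ : Matrix (Fin n) (Fin n) K).det
  set b := ∏ i, ∏ j ∈ Ioi i, (1 - s i * s j)
  set σ := ∏ i, s i
  have hσ : σ ≠ 0 := prod_ne_zero_iff.mpr fun i _ => hs0 i
  have hV : (vandermonde s).det ≠ 0 := det_vandermonde_ne_zero_iff.mpr hs
  have hC : (of fun k l => (1 + s k) * (1 - s l) / (1 - s k * s l)).det =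
      (∏ i, (1 - s i * s i)) * D := by
    have : (of fun k l => (1 + s k) * (1 - s l) / (1 - s k * s l)) =
        diagonal (fun k => 1 + s k) * (of fun l k => (1 - s l * s k)⁻¹) *
          diagonal (fun l => 1 - s l) := by
      ext k l
      simp [mul_diagonal, diagonal_mul]
      ring
    rw [this, det_mul, det_mul, det_diagonal, det_diagonal, mul_right_comm, ← prod_mul_distrib]
    congr 1
    exact prod_congr rfl fun i _ => by ring
  have hne (l k : Fin n) : (s l)⁻¹ ≠ s k := fun h => hss l k (by rw [← h, mul_inv_cancel₀ (hs0 l)])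
  have h1 := det_vandermonde_eq_mul_det_cauchy (x := fun l => (s l)⁻¹) hs hne
  have e1 : ∏ l, ∏ m, ((s l)⁻¹ - s m) = (σ ^ n)⁻¹ * ((∏ i, (1 - s i * s i)) * b ^ 2) := by
    rw [← prod_prod_eq_prod_diag_mul_prod_Ioi (fun i j => 1 - s i * s j)
      (fun i j => by rw [mul_comm]), ← prod_pow, ← prod_inv_distrib, ← prod_mul_distrib]
    refine prod_congr rfl fun l _ => ?_
    have : (s l ^ n)⁻¹ = ∏ _m : Fin n, (s l)⁻¹ := by simp
    rw [this, ← prod_mul_distrib]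
    refine prod_congr rfl fun m _ => ?_
    have := hs0 l
    field_simp
  have e2 : (of fun l k => ((s l)⁻¹ - s k)⁻¹ : Matrix (Fin n) (Fin n) K).det = σ * D := by
    have : (of fun l k => ((s l)⁻¹ - s k)⁻¹) =
        diagonal s * (of fun l k => (1 - s l * s k)⁻¹) := by
      ext l k
      have := hs0 l
      have e : (s l)⁻¹ - s k = (s l)⁻¹ * (1 - s l * s k) := by field_simp
      simp [diagonal_mul, e, mul_comm]
    rw [this, det_mul, det_diagonal]
  have e3 : (vandermonde fun l => (s l)⁻¹).det ^ 2 * σ ^ (2 * n) = σ ^ 2 * (vandermonde s).det ^ 2 := by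
    have hq : σ ^ (2 * n) = σ ^ 2 * (∏ i, ∏ j ∈ Ioi i, s i * s j) ^ 2 := by
      have h := prod_prod_eq_prod_diag_mul_prod_Ioi (fun i j => s i * s j) fun i j => mul_comm _ _
      have h' : ∏ i, ∏ j, s i * s j = σ ^ (2 * n) := by
        simp only [prod_mul_distrib, prod_const, card_univ, Fintype.card_fin, prod_pow]
        ring
      rw [← h', h, prod_mul_distrib, sq σ]
    have hV2 : (vandermonde fun l => (s l)⁻¹).det ^ 2 * (∏ i, ∏ j ∈ Ioi i, s i * s j) ^ 2 =
        (vandermonde s).det ^ 2 := by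
      simp only [det_vandermonde, ← prod_pow, ← prod_mul_distrib]
      refine prod_congr rfl fun i _ => prod_congr rfl fun j _ => ?_
      have := hs0 i
      have := hs0 j
      field_simp
      ring
    rw [hq, ← hV2]
    ring
  have h2 := congrArg (· ^ 2) h1
  simp only [e1, e2, mul_pow, Lagrange.prod_nodalWeight_sq] at h2
  rw [h2] at e3
  rw [hC]
  refine mul_left_cancel₀ (pow_ne_zero (2 * n) hσ) ?_
  generalize ∏ i, (1 - s i * s i) = d at e3 ⊢
  field_simp at e3
  linear_combination e3

theorem Matrix.det_add_smul_vecMulVec_affine {m R : Type*} [Fintype m] [DecidableEq m] [CommRing R]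
    (B : Matrix m m R) (u v : m → R) :
    ∃ c, ∀ t : R, (B + t • vecMulVec u v).det = B.det + t * c := by
  let M : Matrix (m ⊕ Unit) (m ⊕ Unit) R := fromBlocks B (replicateCol Unit u) 0 1
  have key (t : R) : (B + t • vecMulVec u v).det =
      (M.updateRow (Sum.inr ()) (t • Sum.elim (-v) 0 + M (Sum.inr ()))).det := by
    have : M.updateRow (Sum.inr ()) (t • Sum.elim (-v) 0 + M (Sum.inr ())) =
        fromBlocks B (replicateCol Unit u) (replicateRow Unit (-(t • v))) 1 := by
      ext (i | i) (j | j) <;> simp [M, updateRow_apply]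
    rw [this, det_fromBlocks_one₂₂]
    congr 1
    ext i j
    simp [Matrix.mul_apply, vecMulVec_apply]
    ring
  refine ⟨(M.updateRow (Sum.inr ()) (Sum.elim (-v) 0)).det, fun t => ?_⟩
  rw [key, det_updateRow_add, det_updateRow_smul, updateRow_eq_self, add_comm]
  simp [M]

theorem Matrix.det_skew_add_smul_vecMulVec {m K : Type*} [Fintype m] [DecidableEq m] [Field K]
    [CharZero K] (hm : Odd (Fintype.card m)) {A : Matrix m m K} (hA : Aᵀ = -A) (u : m → K) (t : K) :
    (A + t • vecMulVec u u).det = t * (A + vecMulVec u u).det := by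
  obtain ⟨c, hc⟩ := det_add_smul_vecMulVec_affine A u u
  have h0 : A.det = 0 := by
    have h := det_transpose A
    rw [hA, det_neg, hm.neg_one_pow] at h
    exact self_eq_neg.mp (by linear_combination -h)
  have h1 := hc 1
  rw [one_smul] at h1
  rw [h1, hc t, h0]
  ring

/-- A real matrix whose quadratic form is nonnegative has nonnegative determinant. -/
theorem Matrix.det_nonneg_of_dotProduct_mulVec_nonneg {m : Type*} [Fintype m] [DecidableEq m]
    {M : Matrix m m ℝ} (hM : ∀ v, 0 ≤ v ⬝ᵥ M *ᵥ v) : 0 ≤ M.det := by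
  by_contra! hneg
  let f : ℝ → ℝ := fun t => ((1 - t) • (1 : Matrix m m ℝ) + t • M).det
  have hf : Continuous f := by
    apply Continuous.matrix_det
    fun_prop
  obtain ⟨t, ht, h0⟩ := intermediate_value_Icc' zero_le_one hf.continuousOn
    (show (0 : ℝ) ∈ Set.Icc (f 1) (f 0) by simp [f, hneg.le])
  have ht1 : t ≠ 1 := by
    rintro rfl
    simp [f] at h0
    exact hneg.ne h0
  obtain ⟨v, hv, hMv⟩ := exists_mulVec_eq_zero_iff.mpr h0
  have h := congrArg (v ⬝ᵥ ·) hMv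
  simp only [add_mulVec, smul_mulVec, one_mulVec, dotProduct_add, dotProduct_smul,
    dotProduct_zero, smul_eq_mul] at h
  have hvv : 0 < v ⬝ᵥ v := lt_of_le_of_ne
    (by simpa [dotProduct] using sum_nonneg fun i _ => mul_self_nonneg (v i))
    (fun h => hv (dotProduct_self_eq_zero.mp h.symm))
  have h1 : 0 < 1 - t := sub_pos.mpr (lt_of_le_of_ne ht.2 ht1)
  have := mul_pos h1 hvv
  have := mul_nonneg ht.1 (hM v)
  linarith

theorem Matrix.det_skew_add_one_nonneg {m : Type*} [Fintype m] [DecidableEq m]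
    {A : Matrix m m ℝ} (hA : Aᵀ = -A) : 0 ≤ (A + vecMulVec 1 1).det := by
  refine det_nonneg_of_dotProduct_mulVec_nonneg fun v => ?_
  have h0 : v ⬝ᵥ A *ᵥ v = 0 := by
    have h : v ⬝ᵥ A *ᵥ v = v ⬝ᵥ Aᵀ *ᵥ v := by
      rw [mulVec_transpose, dotProduct_comm v (v ᵥ* A), dotProduct_mulVec]
    rw [hA, neg_mulVec, dotProduct_neg] at h
    linarith
  rw [add_mulVec, dotProduct_add, h0, zero_add]
  have : v ⬝ᵥ vecMulVec 1 1 *ᵥ v = (∑ i, v i) * ∑ i, v i := by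
    simp [dotProduct, mulVec, vecMulVec_apply, ← sum_mul]
  rw [this]
  exact mul_self_nonneg _

/-- Adding multiples of a column (resp. row) of a skew matrix of odd order to all columns
(resp. rows) does not affect the coefficient of the all-ones perturbation. -/
theorem Matrix.det_skew_add_border {m K : Type*} [Fintype m] [DecidableEq m] [Field K]
    [CharZero K] (hm : Odd (Fintype.card m)) {A : Matrix m m K} (hA : Aᵀ = -A) (i₀ : m)
    (x y z : K) :
    (A + x • vecMulVec 1 1 + y • vecMulVec (A.col i₀) 1 + z • vecMulVec 1 (A.col i₀)).det =
      x * (A + vecMulVec 1 1).det := by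
  have hA' (i j : m) : A j i = - A i j := congrFun₂ hA i j
  have h00 : A i₀ i₀ = 0 := self_eq_neg.mp (hA' i₀ i₀)
  have generic (y z : K) (hy : 1 + y ≠ 0) (hz : 1 - z ≠ 0) :
      (A + x • vecMulVec 1 1 + y • vecMulVec (A.col i₀) 1 + z • vecMulVec 1 (A.col i₀)).det =
      x * (A + vecMulVec 1 1).det := by
    let L : Matrix m m K :=
      1 + replicateCol Unit (fun _ => -z) * replicateRow Unit (Pi.single i₀ (1 : K))
    let R : Matrix m m K := 1 + replicateCol Unit (Pi.single i₀ y) * replicateRow Unit (1 : m → K)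
    have hL : L.det = 1 - z := by
      simp only [L, det_one_add_replicateCol_mul_replicateRow]
      simp [sub_eq_add_neg]
    have hR : R.det = 1 + y := by
      simp only [R, det_one_add_replicateCol_mul_replicateRow]
      simp
    have hLB (B : Matrix m m K) (i j : m) : (L * B) i j = B i j - z * B i₀ j := by
      simp only [L, Matrix.add_mul, Matrix.one_mul, Matrix.add_apply]
      simp [Matrix.mul_apply, Pi.single_apply, sub_eq_add_neg]
    have hBR (B : Matrix m m K) (i j : m) : (B * R) i j = B i j + y * B i i₀ := by
      simp only [R, Matrix.mul_add, Matrix.mul_one, Matrix.add_apply]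
      simp [Matrix.mul_apply, Pi.single_apply, mul_comm]
    have hfac : A + x • vecMulVec 1 1 + y • vecMulVec (A.col i₀) 1 + z • vecMulVec 1 (A.col i₀) =
        L * (A + (x / ((1 - z) * (1 + y))) • vecMulVec 1 1) * R := by
      ext i j
      rw [hBR, hLB, hLB]
      simp only [Matrix.add_apply, Matrix.smul_apply, vecMulVec_apply, col_apply, Pi.one_apply,
        h00, hA' j i₀, smul_eq_mul]
      field_simp
      ring
    rw [hfac, det_mul, det_mul, hL, hR, det_skew_add_smul_vecMulVec hm hA]
    field_simp
  have affine (a c d e : K) (h : ∀ t, t ≠ e → a + t * c = d) : a + e * c = d := by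
    have h1 := h (e + 1) (by simp)
    have h2 := h (e + 2) (by simp)
    linear_combination 2 * h1 - h2
  have step (z : K) (hz : 1 - z ≠ 0) (y : K) :
      (A + x • vecMulVec 1 1 + y • vecMulVec (A.col i₀) 1 + z • vecMulVec 1 (A.col i₀)).det =
      x * (A + vecMulVec 1 1).det := by
    by_cases hy : 1 + y = 0
    · obtain ⟨c, hc⟩ := det_add_smul_vecMulVec_affine
        (A + x • vecMulVec 1 1 + z • vecMulVec 1 (A.col i₀)) (A.col i₀) 1
      rw [add_right_comm, hc]
      refine affine _ _ _ _ fun t ht => ?_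
      rw [← hc, add_right_comm]
      exact generic t z (fun h => ht (by linear_combination h - hy)) hz
    · exact generic y z hy hz
  by_cases hz : 1 - z = 0
  · obtain ⟨c, hc⟩ := det_add_smul_vecMulVec_affine
      (A + x • vecMulVec 1 1 + y • vecMulVec (A.col i₀) 1) 1 (A.col i₀)
    rw [hc]
    refine affine _ _ _ _ fun t ht => ?_
    rw [← hc]
    exact step t (fun h => ht (by linear_combination hz - h)) y
  · exact step z hz y

theorem Matrix.det_skew_add_one_sq {K : Type*} [Field K] [CharZero K] {n m : ℕ}
    (hn : n = 2 * m + 1) {s v : Fin n → K} {γ P κ : K} {A : Matrix (Fin n) (Fin n) K}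
    (hA : Aᵀ = -A) (hsv : ∀ i, v i = s i ^ 2) (hs0 : ∀ i, s i ≠ 0)
    (hv : Function.Injective v) (hvv : ∀ i j, v i * v j ≠ 1) (hγ : γ ≠ 0) (hP : P ≠ 0)
    (hsn : ∀ i, s i ^ (2 * n + 1) = 1) (hκ : κ = ∏ i, -v i)
    (hdiff : ∀ k, (∏ j ∈ univ.erase k, (v k - v j)) * (∏ j, (v k - (v j)⁻¹)) * (v k - 1) * v k = P)
    (hγA : ∀ i j : Fin n, γ * A i j =
      ∑ l, (v l ^ (i : ℕ) * (v l)⁻¹ ^ (j : ℕ) - (v l)⁻¹ ^ (i : ℕ) * v l ^ (j : ℕ))) :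
    (A + vecMulVec 1 1).det ^ 2 * (γ ^ 2) ^ (2 * m) * (∏ i, ∏ j ∈ Ioi i, (s i + s j)) ^ 4 *
      (∏ i, ∏ j ∈ Ioi i, (1 - s i * s j)) ^ 4 = (κ * P) ^ (4 * m) := by
  have hs : Function.Injective s := fun i j h => hv (by rw [hsv, hsv, h])
  have hss (i j) : s i * s j ≠ 1 := fun h => hvv i j (by rw [hsv, hsv, ← mul_pow, h, one_pow])
  have hv0 (i) : v i ≠ 0 := by rw [hsv]; exact pow_ne_zero _ (hs0 i)
  have hv1 (i) : v i ≠ 1 := fun h => hvv i i (by rw [h, one_mul])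
  have hκ0 : κ ≠ 0 := by rw [hκ]; exact prod_ne_zero_iff.mpr fun i _ => neg_ne_zero.mpr (hv0 i)
  set w := Lagrange.nodalWeight univ v with hw
  set F1 := ∏ k, (1 - v k) with hF1
  have hF10 : F1 ≠ 0 := prod_ne_zero_iff.mpr fun i _ => sub_ne_zero.mpr (hv1 i).symm
  have hVs : (vandermonde s).det ≠ 0 := det_vandermonde_ne_zero_iff.mpr hs
  have lag1 (i : Fin n) : ∑ k, w k / (v k - 1) * v k ^ (i : ℕ) = - F1⁻¹ := by
    have h := Lagrange.pow_eq_nodal_mul_sum hv (fun k => (hv1 k).symm) i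
    rw [one_pow, ← hw] at h
    rw [← eq_inv_of_mul_eq_one_right h.symm, ← sum_neg_distrib]
    refine sum_congr rfl fun k _ => ?_
    rw [← neg_sub (v k) 1, inv_neg]
    ring
  have lag2 (l i : Fin n) : (v l)⁻¹ ^ (i : ℕ) = ∑ k, κ * P * s l * w l * w k /
      ((v l - 1) * (1 - v k * v l)) * v k ^ (i : ℕ) := by
    have hne (k) : (v l)⁻¹ ≠ v k := fun h => hvv l k (by rw [← h, mul_inv_cancel₀ (hv0 l)])
    rw [Lagrange.pow_eq_nodal_mul_sum hv hne i, mul_sum, ← hw]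
    have e1 : ∏ j, ((v l)⁻¹ - v j) = κ * s l * ∏ j, (v l - (v j)⁻¹) := by
      have e2 : s l = ∏ _j : Fin n, (v l)⁻¹ := by
        rw [prod_const, card_univ, Fintype.card_fin, inv_pow, hsv, ← pow_mul]
        refine eq_inv_of_mul_eq_one_left ?_
        rw [← pow_succ', hsn]
      rw [e2, hκ, ← prod_mul_distrib, ← prod_mul_distrib]
      refine prod_congr rfl fun j _ => ?_
      have := hv0 l
      have := hv0 j
      field_simp
      ring
    have e3 : ∏ j, (v l - (v j)⁻¹) = P * w l / ((v l - 1) * v l) := by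
      have h := hdiff l
      have hW : w l * ∏ j ∈ univ.erase l, (v l - v j) = 1 := by
        rw [hw, Lagrange.nodalWeight, ← prod_mul_distrib]
        exact prod_eq_one fun j hj =>
          inv_mul_cancel₀ (sub_ne_zero.mpr fun h => (ne_of_mem_erase hj) (hv h).symm)
      rw [eq_div_iff (mul_ne_zero (sub_ne_zero.mpr (hv1 l)) (hv0 l)), ← h]
      linear_combination (-(∏ j, (v l - (v j)⁻¹)) * (v l - 1) * v l) * hW
    refine sum_congr rfl fun k _ => ?_
    rw [e1, e3]
    have h1 := hv0 l
    have h2 := sub_ne_zero.mpr (hv1 l)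
    have h3 := sub_ne_zero.mpr (hvv k l).symm
    have h4 : (v l)⁻¹ - v k = (1 - v k * v l) / v l := by field_simp
    rw [h4]
    field_simp
  set t := κ * P / (γ * F1 ^ 2) with ht
  let B : Matrix (Fin n) (Fin n) K := of fun i k => v k ^ (i : ℕ) * (w k / (v k - 1))
  have hB : B.det = (vandermonde v).det * ∏ k, (w k / (v k - 1)) := by
    rw [← det_transpose (vandermonde v), ← det_diagonal, ← det_mul]
    congr 1
    ext i k
    simp [B, mul_diagonal, vandermonde_apply]
  have hfac : A + t • vecMulVec 1 1 = (κ * P / γ) • (B *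
      (of fun k l => (1 + s k) * (1 - s l) / (1 - s k * s l))ᵀ * Bᵀ) := by
    ext i j
    have eJ : t = κ * P / γ * ∑ l, ∑ k, (w l / (v l - 1) * v l ^ (i : ℕ)) *
        (w k / (v k - 1) * v k ^ (j : ℕ)) := by
      rw [← sum_mul_sum, lag1, lag1, ht]
      field_simp
    have eA : A i j = κ * P / γ * ∑ l, ∑ k, (w l / (v l - 1) * v l ^ (i : ℕ)) *
        (w k / (v k - 1) * v k ^ (j : ℕ)) * ((s k - s l) / (1 - s k * s l)) := by
      have h : γ * A i j = ∑ l, ∑ k, (v l ^ (i : ℕ) * v k ^ (j : ℕ)) *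
          (κ * P * s l * w l * w k / ((v l - 1) * (1 - v k * v l)) -
            κ * P * s k * w k * w l / ((v k - 1) * (1 - v l * v k))) := by
        rw [hγA, sum_sub_distrib]
        simp only [mul_sub, sum_sub_distrib]
        congr 1
        · refine sum_congr rfl fun l _ => ?_
          rw [lag2, mul_sum]
          exact sum_congr rfl fun k _ => by ring
        · rw [sum_comm]
          refine sum_congr rfl fun l _ => ?_
          rw [lag2, sum_mul]
          exact sum_congr rfl fun k _ => by ring
      rw [← mul_right_inj' hγ, h, ← mul_assoc, mul_div_cancel₀ _ hγ, mul_sum]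
      refine sum_congr rfl fun l _ => ?_
      rw [mul_sum]
      refine sum_congr rfl fun k _ => ?_
      have h1 := sub_ne_zero.mpr (hv1 l)
      have h2 := sub_ne_zero.mpr (hv1 k)
      have h3 := sub_ne_zero.mpr (hvv k l).symm
      have h4 := sub_ne_zero.mpr (hss k l).symm
      have h5 := sub_ne_zero.mpr (hvv l k).symm
      have h6 : 1 + s k * s l ≠ 0 := fun h => hvv k l (by
        rw [hsv, hsv, ← mul_pow, eq_neg_of_add_eq_zero_right h]; norm_num)
      have h7 : 1 - v k * v l = (1 - s k * s l) * (1 + s k * s l) := by rw [hsv, hsv]; ring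
      have key : s l / ((v l - 1) * (1 - v k * v l)) - s k / ((v k - 1) * (1 - v l * v k)) =
          (s k - s l) / (1 - s k * s l) / (v k - 1) / (v l - 1) := by
        rw [mul_comm (v l) (v k), h7, div_sub_div _ _ (by positivity) (by positivity), div_div,
          div_div, div_eq_div_iff (by positivity) (by positivity)]
        simp only [hsv]
        ring
      linear_combination (v l ^ (i : ℕ) * v k ^ (j : ℕ) * κ * P * w l * w k) * key
    simp only [Matrix.add_apply, Matrix.smul_apply, vecMulVec_apply, Pi.one_apply, mul_one,
      smul_eq_mul]
    rw [eA, eJ, ← mul_add, ← sum_add_distrib]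
    congr 1
    simp only [B, ← sum_add_distrib, Matrix.mul_apply, transpose_apply, of_apply, sum_mul]
    rw [sum_comm]
    refine sum_congr rfl fun k _ => sum_congr rfl fun l _ => ?_
    have h4 := sub_ne_zero.mpr (hss k l).symm
    have : (1 + s k) * (1 - s l) / (1 - s k * s l) = (s k - s l) / (1 - s k * s l) + 1 := by
      field_simp
      ring
    rw [this]
    ring
  have hodd : Odd (Fintype.card (Fin n)) := by rw [Fintype.card_fin, hn]; exact odd_two_mul_add_one m
  have hdet := congrArg det hfac
  rw [det_skew_add_smul_vecMulVec hodd hA, det_smul] at hdet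
  simp only [det_mul, det_transpose, hB, Fintype.card_fin, prod_div_distrib] at hdet
  have hF1' : (∏ k, (v k - 1)) ^ 2 = F1 ^ 2 := by
    simp only [hF1, ← prod_pow]
    exact prod_congr rfl fun k _ => by ring
  have hw2 := Lagrange.prod_nodalWeight_sq v
  have hC := det_cauchy_self_sq hs hs0 hss
  have hVv : (vandermonde v).det = (vandermonde s).det * ∏ i, ∏ j ∈ Ioi i, (s i + s j) := by
    simp only [det_vandermonde, ← prod_mul_distrib, hsv]
    exact prod_congr rfl fun i _ => prod_congr rfl fun j _ => by ring
  have hVv0 : (vandermonde v).det ≠ 0 := det_vandermonde_ne_zero_iff.mpr hv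
  generalize (of fun k l => (1 + s k) * (1 - s l) / (1 - s k * s l)).det = dC at *
  generalize (A + vecMulVec 1 1).det = c at *
  rw [← hw] at hw2
  generalize ∏ k, w k = W at *
  generalize ∏ k, (v k - 1) = F2 at *
  have h1 : c * γ ^ (2 * m) * (vandermonde v).det ^ 2 = (κ * P) ^ (2 * m) * dC := by
    have : t * c = (κ * P / γ) ^ n * ((vandermonde v).det ^ 2 * W ^ 2 / F2 ^ 2 * dC) := by
      rw [hdet]; ring
    have hpow : (κ * P / γ) ^ n = (κ * P) ^ (2 * m) / γ ^ (2 * m) * (κ * P / γ) := by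
      rw [hn, pow_succ, div_pow]
    rw [hw2, hF1', ht, hpow] at this
    have h3 : κ * P ≠ 0 := mul_ne_zero hκ0 hP
    generalize (vandermonde v).det = V at *
    generalize κ * P = q at *
    field_simp at this
    linear_combination this
  refine mul_left_cancel₀ (pow_ne_zero 4 hVs) ?_
  rw [hVv] at h1
  linear_combination (c * γ ^ (2 * m) * ((vandermonde s).det * ∏ i, ∏ j ∈ Ioi i, (s i + s j)) ^ 2 +
    (κ * P) ^ (2 * m) * dC) * (∏ i, ∏ j ∈ Ioi i, (1 - s i * s j)) ^ 4 * h1 + (κ * P) ^ (4 * m) * hC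

theorem ZMod.quadraticChar_neg_one_of_mod_four_eq_three {p : ℕ} [Fact p.Prime] (hp : p % 4 = 3) :
    quadraticChar (ZMod p) (-1) = -1 := by
  rw [quadraticChar_neg_one_iff_not_isSquare, ZMod.exists_sq_eq_neg_one_iff, hp]
  decide

theorem ZMod.exists_equiv_quadraticResidues {p n : ℕ} [Fact p.Prime] (hp : p % 4 = 3)
    (hn : p = 2 * n + 1) : ∃ (r : Fin n → ZMod p) (e : Option (Fin n ⊕ Fin n) ≃ ZMod p),
      (∀ i, quadraticChar (ZMod p) (r i) = 1) ∧ (∀ i, quadraticChar (ZMod p) (-r i) = -1) ∧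
      e none = 0 ∧ (∀ i, e (some (Sum.inl i)) = r i) ∧ ∀ i, e (some (Sum.inr i)) = -r i := by
  have hneg := ZMod.quadraticChar_neg_one_of_mod_four_eq_three hp
  have hne (k : ℕ) (h0 : 0 < k) (hk : k < p) : (k : ZMod p) ≠ 0 := fun h =>
    absurd (Nat.le_of_dvd h0 ((ZMod.natCast_eq_zero_iff k p).mp h)) hk.not_ge
  let r : Fin n → ZMod p := fun i => ((i + 1 : ℕ) : ZMod p) ^ 2
  have hr (i) : quadraticChar (ZMod p) (r i) = 1 :=
    quadraticChar_sq_one' (hne _ (by lia) (by lia))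
  have hr' (i) : quadraticChar (ZMod p) (-r i) = -1 := by
    rw [neg_eq_neg_one_mul, map_mul, hneg, hr, mul_one]
  have hrinj : Function.Injective r := fun i j h => by
    rcases sq_eq_sq_iff_eq_or_eq_neg.mp h with h | h
    · have := (ZMod.natCast_eq_natCast_iff' _ _ _).mp h
      rw [Nat.mod_eq_of_lt (by lia), Nat.mod_eq_of_lt (by lia)] at this
      exact Fin.ext (by lia)
    · rw [eq_neg_iff_add_eq_zero, ← Nat.cast_add] at h
      exact absurd h (hne _ (by lia) (by lia))
  let f : Option (Fin n ⊕ Fin n) → ZMod p := fun o => o.elim 0 (Sum.elim r fun i => -r i)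
  have hχ0 : quadraticChar (ZMod p) 0 = 0 := quadraticChar_zero
  have hf : Function.Bijective f := by
    rw [Fintype.bijective_iff_injective_and_card]
    refine ⟨?_, by simp [ZMod.card, hn]; ring⟩
    rintro (_ | i | i) (_ | j | j) h
    all_goals have h' := congrArg (quadraticChar (ZMod p)) h
    all_goals simp only [f, Option.elim, Sum.elim_inl, Sum.elim_inr, hr, hr', hχ0] at h'
    all_goals first | rfl | norm_num at h'
    · exact congrArg _ (congrArg _ (hrinj h))
    · exact congrArg _ (congrArg _ (hrinj (neg_injective h)))
  exact ⟨r, Equiv.ofBijective f hf, hr, hr', rfl, fun _ => rfl, fun _ => rfl⟩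

theorem AddChar.isPrimitiveRoot_of_injective {p : ℕ} [Fact p.Prime] {K : Type*} [Field K]
    {ψ : AddChar (ZMod p) K} (hψ : Function.Injective ψ) {b : ZMod p} (hb : b ≠ 0) :
    IsPrimitiveRoot (ψ b) p := by
  rw [IsPrimitiveRoot.iff_orderOf]
  refine orderOf_eq_prime ?_ fun h => hb (hψ (by rw [h, AddChar.map_zero_eq_one]))
  rw [← AddChar.map_nsmul_eq_pow, nsmul_eq_mul, CharP.cast_eq_zero, zero_mul,
    AddChar.map_zero_eq_one]

theorem AddChar.prod_erase_zero_one_sub {p : ℕ} [Fact p.Prime] {K : Type*} [Field K]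
    {ψ : AddChar (ZMod p) K} (hψ : Function.Injective ψ) :
    ∏ a ∈ univ.erase 0, (1 - ψ a) = p := by
  obtain ⟨q, rfl⟩ : ∃ q, p = q + 1 := ⟨p - 1, (Nat.sub_add_cancel (Fact.out : p.Prime).one_le).symm⟩
  have h := (isPrimitiveRoot_of_injective hψ one_ne_zero).prod_one_sub_pow_eq_order
  rw [Nat.cast_succ, ← h]
  refine prod_nbij' (fun a => a.val - 1) (fun k => ((k + 1 : ℕ) : ZMod (q + 1))) ?_ ?_ ?_ ?_ ?_
  · intro a ha
    have := ZMod.val_lt a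
    have : a.val ≠ 0 := (ZMod.val_ne_zero a).mpr (ne_of_mem_erase ha)
    exact mem_range.mpr (by lia)
  · intro k hk
    refine mem_erase.mpr ⟨fun h => ?_, mem_univ _⟩
    have := Nat.le_of_dvd k.succ_pos ((ZMod.natCast_eq_zero_iff _ _).mp h)
    have := mem_range.mp hk
    lia
  · intro a ha
    have : a.val ≠ 0 := (ZMod.val_ne_zero a).mpr (ne_of_mem_erase ha)
    rw [Nat.sub_add_cancel (by lia), ZMod.natCast_rightInverse]
  · intro k hk
    rw [ZMod.val_natCast, Nat.mod_eq_of_lt (by have := mem_range.mp hk; lia), Nat.add_sub_cancel]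
  · intro a ha
    have : a.val ≠ 0 := (ZMod.val_ne_zero a).mpr (ne_of_mem_erase ha)
    rw [Nat.sub_add_cancel (by lia), ← AddChar.map_nsmul_eq_pow, nsmul_one,
      ZMod.natCast_rightInverse]

theorem AddChar.prod_erase_sub {p : ℕ} [Fact p.Prime] {K : Type*} [Field K]
    {ψ : AddChar (ZMod p) K} (hψ : Function.Injective ψ) (b : ZMod p) :
    (∏ a ∈ univ.erase b, (ψ b - ψ a)) * ψ b = p := by
  have h : ∏ a ∈ univ.erase b, (ψ b - ψ a) = ∏ a ∈ univ.erase 0, (ψ b * (1 - ψ a)) := by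
    refine prod_nbij' (fun a => a - b) (fun a => b + a) ?_ ?_ ?_ ?_ ?_
    · intro a ha; simpa [sub_eq_zero] using ha
    · intro a ha; simpa using ha
    · intro a ha; ring
    · intro a ha; ring
    · intro a ha
      rw [mul_sub, ← AddChar.map_add_eq_mul, add_sub_cancel, mul_one]
  have h1 : ψ b ^ p = 1 := by
    rw [← AddChar.map_nsmul_eq_pow, nsmul_eq_mul, CharP.cast_eq_zero, zero_mul,
      AddChar.map_zero_eq_one]
  rw [h, prod_mul_distrib, prod_erase_zero_one_sub hψ, prod_const, card_erase_of_mem (mem_univ _),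
    card_univ, ZMod.card, mul_right_comm, ← pow_succ,
    Nat.sub_add_cancel (Fact.out : p.Prime).one_le, h1, one_mul]

theorem AddChar.isIntegral_zmod {p : ℕ} [Fact p.Prime] {K : Type*} [Field K]
    (ψ : AddChar (ZMod p) K) (a : ZMod p) : IsIntegral ℤ (ψ a) := by
  refine IsIntegral.of_pow (Fact.out : p.Prime).pos ?_
  rw [← AddChar.map_nsmul_eq_pow, nsmul_eq_mul, CharP.cast_eq_zero, zero_mul,
    AddChar.map_zero_eq_one]
  exact isIntegral_one

theorem AddChar.exists_isIntegral_one_sub_pow {p : ℕ} [Fact p.Prime] {K : Type*} [Field K]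
    {ψ : AddChar (ZMod p) K} (hψ : Function.Injective ψ) (a : ZMod p) :
    ∃ β, IsIntegral ℤ β ∧ (1 - ψ a) ^ (p - 1) = p * β := by
  have key (b : ZMod p) (hb : b ∈ univ.erase 0) : ∃ β, IsIntegral ℤ β ∧ 1 - ψ a = (1 - ψ b) * β := by
    refine ⟨∑ i ∈ range (a / b).val, ψ b ^ i,
      IsIntegral.sum _ fun i _ => (ψ.isIntegral_zmod b).pow i, ?_⟩
    rw [mul_neg_geom_sum, ← AddChar.map_nsmul_eq_pow, nsmul_eq_mul, ZMod.natCast_rightInverse,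
      div_mul_cancel₀ _ (ne_of_mem_erase hb)]
  choose! β hβ h using key
  refine ⟨∏ b ∈ univ.erase 0, β b, IsIntegral.prod _ hβ, ?_⟩
  rw [← prod_erase_zero_one_sub hψ, ← prod_mul_distrib, ← prod_congr rfl h, prod_const,
    card_erase_of_mem (mem_univ _), card_univ, ZMod.card]

theorem quadraticChar_mul_gaussSum_eq_sum {p n : ℕ} [Fact p.Prime] {r : Fin n → ZMod p}
    {e : Option (Fin n ⊕ Fin n) ≃ ZMod p} (hr : ∀ i, quadraticChar (ZMod p) (r i) = 1)
    (hr' : ∀ i, quadraticChar (ZMod p) (-r i) = -1) (he : e none = 0)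
    (hel : ∀ i, e (some (Sum.inl i)) = r i) (her : ∀ i, e (some (Sum.inr i)) = -r i)
    {K : Type*} [Field K] (ψ : AddChar (ZMod p) K) (a : ZMod p) :
    gaussSum ((quadraticChar (ZMod p)).ringHomComp (Int.castRingHom K)) ψ *
      (quadraticChar (ZMod p) a : K) = ∑ l, (ψ (a * r l) - ψ (-(a * r l))) := by
  set χ := (quadraticChar (ZMod p)).ringHomComp (Int.castRingHom K) with hχ
  have h : gaussSum χ (ψ.mulShift a) = ∑ l, (ψ (a * r l) - ψ (-(a * r l))) := by
    rw [gaussSum, ← e.sum_comp, Fintype.sum_option, Fintype.sum_sum_type, ← sum_add_distrib]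
    simp [hχ, he, hel, her, hr, hr', sub_eq_add_neg]
  by_cases ha : a = 0
  · simp [ha]
  · rw [← h]
    have h2 := gaussSum_mulShift χ ψ (Units.mk0 a ha)
    rw [Units.val_mk0] at h2
    have h3 : (quadraticChar (ZMod p) a : K) = χ a := rfl
    rw [← h2, h3, mul_right_comm, ← sq, hχ, MulChar.ringHomComp_apply, ← map_pow,
      quadraticChar_sq_one ha, map_one, one_mul]

theorem isUnit_of_isIntegral_mul_eq_one {K : Type*} [Field K] [CharZero K] {c : ℤ} {J : K}
    (hJ : IsIntegral ℤ J) (h : (c : K) * J = 1) : IsUnit c := by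
  have hJ' : J = algebraMap ℚ K (c : ℚ)⁻¹ := by
    rw [map_inv₀, map_intCast]
    exact eq_inv_of_mul_eq_one_right h
  rw [hJ', isIntegral_algebraMap_iff (algebraMap ℚ K).injective,
    IsIntegrallyClosed.isIntegral_iff] at hJ
  obtain ⟨d, hd⟩ := hJ
  have hc : (c : ℚ) ≠ 0 := by
    rintro hc
    rw [Int.cast_eq_zero.mp hc, Int.cast_zero, zero_mul] at h
    exact zero_ne_one h
  refine IsUnit.of_mul_eq_one d ?_
  have : (c : ℚ) * d = 1 := by
    rw [← mul_inv_cancel₀ hc, ← hd]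
    simp
  exact_mod_cast this

/-- The skew matrix of quadratic residue symbols of differences, plus the all-ones matrix, has
determinant `1`. -/
theorem Matrix.det_quadraticChar_sub_add_one {p n : ℕ} [Fact p.Prime] (hp : p % 4 = 3)
    (hn : p = 2 * n + 1) :
    ((of fun i j : Fin n => quadraticChar (ZMod p) ((i : ℕ) - (j : ℕ))) +
      vecMulVec 1 1).det = 1 := by
  obtain ⟨m, hm⟩ : ∃ m, n = 2 * m + 1 := ⟨n / 2, by lia⟩
  set A : Matrix (Fin n) (Fin n) ℤ :=
    of fun i j : Fin n => quadraticChar (ZMod p) ((i : ℕ) - (j : ℕ)) with hA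
  have hneg := ZMod.quadraticChar_neg_one_of_mod_four_eq_three hp
  have hskew : Aᵀ = -A := by
    ext i j
    simp only [hA, transpose_apply, Matrix.neg_apply, of_apply]
    rw [← neg_sub, neg_eq_neg_one_mul, map_mul, hneg, neg_one_mul]
  have hmap {K : Type} [Field K] : (A.map (Int.castRingHom K) + vecMulVec 1 1).det =
      ((A + vecMulVec 1 1).det : K) := by
    refine Eq.trans (congrArg det ?_) (RingHom.map_det (Int.castRingHom K) _).symm
    ext i j
    simp
  have hskew' {K : Type} [Field K] :
      (A.map (Int.castRingHom K))ᵀ = -A.map (Int.castRingHom K) := by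
    rw [← transpose_map, hskew]
    ext i j
    simp
  have hnonneg : 0 ≤ (A + vecMulVec 1 1).det := by
    have h := det_skew_add_one_nonneg (hskew' (K := ℝ))
    rw [hmap] at h
    exact_mod_cast h
  suffices IsUnit (A + vecMulVec 1 1).det by
    rcases Int.isUnit_iff.mp this with h | h
    · exact h
    · lia
  obtain ⟨r, e, hr, hr', he, hel, her⟩ := ZMod.exists_equiv_quadraticResidues hp hn
  let ψ : AddChar (ZMod p) ℂ := ZMod.stdAddChar
  have hψ : Function.Injective ψ := ZMod.injective_stdAddChar
  have hchar : ringChar (ZMod p) ≠ 2 := by rw [ZMod.ringChar_zmod_n]; lia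
  have h2 : (2 : ZMod p) ≠ 0 := Ring.two_ne_zero hchar
  have hrinj : Function.Injective r := fun i j h => by
    rw [← hel, ← hel] at h
    exact Sum.inl_injective (Option.some_injective _ (e.injective h))
  have hrr (i j) : r i + r j ≠ 0 := fun h => by
    have := hr i
    rw [eq_neg_of_add_eq_zero_left h, hr'] at this
    exact absurd this (by decide)
  set χ := (quadraticChar (ZMod p)).ringHomComp (Int.castRingHom ℂ) with hχ
  set γ := gaussSum χ ψ with hγ
  have hp0 : (p : ℂ) ≠ 0 := Nat.cast_ne_zero.mpr (Fact.out : p.Prime).ne_zero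
  have hγ2 : γ ^ 2 = -p := by
    rw [hγ, gaussSum_sq _ (MulChar.IsQuadratic.comp (quadraticChar_isQuadratic _) _)
      (ZMod.isPrimitive_stdAddChar p),
      ZMod.card, MulChar.ringHomComp_apply, hneg]
    · simp
    · refine (MulChar.ringHomComp_ne_one_iff (RingHom.injective_int _)).mpr (quadraticChar_ne_one hchar)
  have hγ0 : γ ≠ 0 := fun h => hp0 (by rw [h] at hγ2; linear_combination hγ2)
  have hpow (a : ZMod p) : ψ a ^ p = 1 := by
    rw [← AddChar.map_nsmul_eq_pow, nsmul_eq_mul, CharP.cast_eq_zero, zero_mul,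
      AddChar.map_zero_eq_one]
  set v : Fin n → ℂ := fun i => ψ (r i) with hv
  set s : Fin n → ℂ := fun i => ψ (r i / 2) with hs
  set κ := ∏ i, -v i with hκ
  have hκ0 : κ ≠ 0 := prod_ne_zero_iff.mpr fun i _ => neg_ne_zero.mpr ((ψ.val_isUnit _).ne_zero)
  have hdiff (k) : (∏ j ∈ univ.erase k, (v k - v j)) * (∏ j, (v k - (v j)⁻¹)) * (v k - 1) * v k =
      (p : ℂ) := by
    rw [← AddChar.prod_erase_sub hψ (r k)]
    congr 1
    have h1 : ∏ a ∈ univ.erase (r k), (ψ (r k) - ψ a) =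
        ∏ a, if a = r k then 1 else ψ (r k) - ψ a := by
      rw [← mul_prod_erase univ _ (mem_univ (r k)), if_pos rfl, one_mul]
      exact prod_congr rfl fun a ha => (if_neg (ne_of_mem_erase ha)).symm
    have h3 : ∏ j ∈ univ.erase k, (v k - v j) =
        ∏ j, if r j = r k then 1 else ψ (r k) - ψ (r j) := by
      rw [← mul_prod_erase univ _ (mem_univ k), if_pos rfl, one_mul]
      exact prod_congr rfl fun a ha => (if_neg (hrinj.ne (ne_of_mem_erase ha))).symm
    have h4 : (0 : ZMod p) ≠ r k := fun h => hrr k k (by rw [← h, add_zero])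
    have h5 (j) : -r j ≠ r k := fun h => hrr k j (by rw [← h, neg_add_cancel])
    rw [h1, ← e.prod_comp, Fintype.prod_option, Fintype.prod_sum_type, h3]
    simp only [he, hel, her, if_neg h4, if_neg (h5 _), AddChar.map_zero_eq_one,
      AddChar.map_neg_eq_inv]
    ring
  have hγA (i j : Fin n) : γ * A.map (Int.castRingHom ℂ) i j =
      ∑ l, (v l ^ (i : ℕ) * (v l)⁻¹ ^ (j : ℕ) - (v l)⁻¹ ^ (i : ℕ) * v l ^ (j : ℕ)) := by
    have h := quadraticChar_mul_gaussSum_eq_sum hr hr' he hel her ψ ((i : ℕ) - (j : ℕ))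
    rw [← hχ, ← hγ] at h
    rw [map_apply, hA, of_apply, Int.coe_castRingHom, h]
    refine sum_congr rfl fun l _ => ?_
    simp only [hv, ← AddChar.map_neg_eq_inv, ← AddChar.map_nsmul_eq_pow, ← AddChar.map_add_eq_mul,
      nsmul_eq_mul]
    congr 2 <;> ring
  have hmain := det_skew_add_one_sq (A := A.map (Int.castRingHom ℂ)) (s := s) (v := v) hm hskew'
    (fun i => by
      simp only [hs, hv, ← AddChar.map_nsmul_eq_pow, nsmul_eq_mul]
      congr 1
      push_cast
      field_simp)
    (fun i => (ψ.val_isUnit _).ne_zero) (hψ.comp hrinj)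
    (fun i j h => hrr i j (hψ (by rw [AddChar.map_add_eq_mul, h, AddChar.map_zero_eq_one])))
    hγ0 hp0 (fun i => by rw [← hn]; exact hpow _) hκ hdiff hγA
  rw [hmap, hγ2, neg_pow, pow_mul (-1 : ℂ), neg_one_sq, one_pow, one_mul] at hmain
  set u := ∏ i, ∏ j ∈ Ioi i, (s i + s j)
  have hsint (i) : IsIntegral ℤ (s i) := ψ.isIntegral_zmod _
  have hu : IsIntegral ℤ u := IsIntegral.prod _ fun i _ => IsIntegral.prod _ fun j _ =>
    (hsint i).add (hsint j)
  choose β hβ hβ' using AddChar.exists_isIntegral_one_sub_pow hψ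
  set b := ∏ i, ∏ j ∈ Ioi i, (1 - s i * s j) with hb
  obtain ⟨I, hI, hbI⟩ : ∃ I, IsIntegral ℤ I ∧ b ^ (4 * n) = (p : ℂ) ^ (2 * m * n) * I := by
    refine ⟨(∏ i, ∏ j ∈ Ioi i, β (r i / 2 + r j / 2)) ^ 2, (IsIntegral.prod _ fun i _ =>
      IsIntegral.prod _ fun j _ => hβ _).pow 2, ?_⟩
    have h1 : b ^ (2 * n) = (∏ i : Fin n, ∏ j ∈ Ioi i, (p : ℂ)) *
        ∏ i, ∏ j ∈ Ioi i, β (r i / 2 + r j / 2) := by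
      simp only [hb, ← prod_pow, ← prod_mul_distrib]
      refine prod_congr rfl fun i _ => prod_congr rfl fun j _ => ?_
      rw [← hβ', AddChar.map_add_eq_mul, show p - 1 = 2 * n by lia]
    have h3 : (∏ i : Fin n, ∏ j ∈ Ioi i, (p : ℂ)) ^ 2 = (p : ℂ) ^ (2 * m * n) := by
      have h := prod_prod_eq_prod_diag_mul_prod_Ioi (n := n) (fun _ _ => (p : ℂ)) fun _ _ => rfl
      simp only [prod_const (s := univ), card_univ, Fintype.card_fin] at h
      refine mul_left_cancel₀ (pow_ne_zero n hp0) ?_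
      rw [← h, ← pow_add, ← pow_mul]
      congr 1
      rw [hm]
      ring
    rw [← h3, ← mul_pow, ← h1, ← pow_mul]
    congr 1
    ring
  have hκi : IsIntegral ℤ κ⁻¹ := by
    rw [hκ, ← prod_inv_distrib]
    refine IsIntegral.prod _ fun i _ => ?_
    rw [inv_neg, hv, ← AddChar.map_neg_eq_inv]
    exact (ψ.isIntegral_zmod _).neg
  set c := (A + vecMulVec 1 1).det
  have hfin : (c : ℂ) ^ (2 * n) * (u ^ (4 * n) * I) = κ ^ (4 * m * n) := by
    have h := congrArg (· ^ n) hmain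
    simp only [mul_pow, ← pow_mul] at h
    rw [hbI] at h
    refine mul_left_cancel₀ (pow_ne_zero (4 * m * n) hp0) ?_
    have : (p : ℂ) ^ (4 * m * n) = (p : ℂ) ^ (2 * m * n) * (p : ℂ) ^ (2 * m * n) := by
      rw [← pow_add]
      congr 1
      ring
    rw [mul_comm _ (κ ^ _), ← h, this]
    ring
  refine isUnit_of_isIntegral_mul_eq_one (K := ℂ)
    (J := (c : ℂ) ^ (2 * n - 1) * (u ^ (4 * n) * I) * κ⁻¹ ^ (4 * m * n)) ?_ ?_
  · exact (((isIntegral_algebraMap (x := c)).pow _).mul ((hu.pow _).mul hI)).mul (hκi.pow _)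
  · rw [← mul_assoc, ← mul_assoc, ← pow_succ', Nat.sub_add_cancel (by lia), hfin, ← mul_pow,
      mul_inv_cancel₀ hκ0, one_pow]

end

/-- Let `p` be a prime with `p ≡ 3 (mod 4)`. Then for all rationals `x, y, z`,
`det [x + ((i-j)/p) + (i/p)y + (j/p)z]_{0 ≤ i,j ≤ (p-3)/2} = x`. -/
theorem stmt5 (p : ℕ) [Fact p.Prime] (hp : p % 4 = 3) (x y z : ℚ) :
    (Matrix.of fun i j : Fin ((p - 1) / 2) =>
        x + (legendreSym p (((i : ℕ) : ℤ) - ((j : ℕ) : ℤ)) : ℚ)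
          + (legendreSym p ((i : ℕ) : ℤ) : ℚ) * y
          + (legendreSym p ((j : ℕ) : ℤ) : ℚ) * z).det = x := by
  obtain ⟨n, hn⟩ : ∃ n, (p - 1) / 2 = n := ⟨_, rfl⟩
  rw [hn]
  have hpn : p = 2 * n + 1 := by lia
  have hodd : Odd n := Nat.odd_iff.mpr (by lia)
  have hneg := ZMod.quadraticChar_neg_one_of_mod_four_eq_three hp
  have hdet := Matrix.det_quadraticChar_sub_add_one hp hpn
  set A : Matrix (Fin n) (Fin n) ℤ :=
    Matrix.of fun i j : Fin n => quadraticChar (ZMod p) ((i : ℕ) - (j : ℕ)) with hA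
  have hskew : (A.map (Int.castRingHom ℚ)).transpose = -A.map (Int.castRingHom ℚ) := by
    ext i j
    simp only [hA, Matrix.transpose_apply, Matrix.neg_apply, Matrix.map_apply, Matrix.of_apply]
    rw [← neg_sub, neg_eq_neg_one_mul, map_mul, hneg, neg_one_mul, map_neg]
  have hdet' : (A.map (Int.castRingHom ℚ) + Matrix.vecMulVec 1 1).det = 1 := by
    rw [← map_one (Int.castRingHom ℚ), ← hdet, RingHom.map_det]
    congr 1
    ext i j
    simp
  have hborder := Matrix.det_skew_add_border (by rwa [Fintype.card_fin]) hskew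
    (⟨0, hodd.pos⟩ : Fin n) x y z
  rw [hdet', mul_one] at hborder
  refine Eq.trans (congrArg Matrix.det ?_) hborder
  ext i j
  simp [hA, legendreSym]
  ring
end

section
/- Let p be an odd prime. Then for all rational numbers x, det[x + ((i-j)/p)]_{1 ≤ i,j ≤ (p-1)/2} = det[((i-j)/p)]_{0 ≤ i,j ≤ (p-3)/2} + x · det[((i-j)/p) - (i/p) - ((-j)/p)]_{1 ≤ i,j ≤ (p-3)/2}. -/
/-- Adding the constant `x` to every entry of a matrix changes its determinant by `x` times the
determinant of the matrix of second differences based at the corner entry. -/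
theorem Matrix.det_const_add {R : Type*} [CommRing R] {n : ℕ}
    (A : Matrix (Fin (n + 1)) (Fin (n + 1)) R) (x : R) :
    (Matrix.of fun i j => x + A i j).det = A.det + x * (Matrix.of fun i j : Fin n =>
      A i.succ j.succ - A i.succ 0 - A 0 j.succ + A 0 0).det := by
  let c : Fin (n + 1) → R := Fin.cons 0 fun _ => 1
  let D : Matrix (Fin (n + 1)) (Fin (n + 1)) R := Matrix.of fun i j => A i j - c i * A 0 j
  have hx : (Matrix.of fun i j => x + A i j).det
      = (D.updateRow 0 (A 0 + x • fun _ => 1)).det := by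
    refine Matrix.det_eq_of_forall_row_eq_smul_add_const c 0 rfl fun i j => ?_
    refine Fin.cases ?_ (fun i => ?_) i <;> simp [c, D] <;> ring
  have h0 : A.det = (D.updateRow 0 (A 0)).det := by
    refine Matrix.det_eq_of_forall_row_eq_smul_add_const c 0 rfl fun i j => ?_
    refine Fin.cases ?_ (fun i => ?_) i <;> simp [c, D]
  have h1 : (D.updateRow 0 fun _ => 1).det = (Matrix.of fun i j : Fin n =>
      A i.succ j.succ - A i.succ 0 - A 0 j.succ + A 0 0).det := by
    let E : Matrix (Fin (n + 1)) (Fin (n + 1)) R :=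
      Matrix.of fun i j => D.updateRow 0 (fun _ => 1) i j - c j * D.updateRow 0 (fun _ => 1) i 0
    have hE : (D.updateRow 0 fun _ => 1).det = E.det := by
      rw [← Matrix.det_transpose, ← Matrix.det_transpose E]
      refine Matrix.det_eq_of_forall_row_eq_smul_add_const c 0 rfl fun j i => ?_
      simp [E, c]
    rw [hE, Matrix.det_succ_row_zero, Fin.sum_univ_succ]
    have hs : E.submatrix Fin.succ (Fin.succAbove 0) = Matrix.of fun i j : Fin n =>
        A i.succ j.succ - A i.succ 0 - A 0 j.succ + A 0 0 := by
      ext i j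
      simp [E, D, c]
      ring
    rw [hs]
    simp [E, c]
  rw [hx, Matrix.det_updateRow_add, Matrix.det_updateRow_smul, ← h0, h1]


/-- Let `p` be an odd prime. Then for all rationals `x`,
`det [x + ((i-j)/p)]_{1 ≤ i,j ≤ (p-1)/2}
  = det [((i-j)/p)]_{0 ≤ i,j ≤ (p-3)/2}
    + x · det [((i-j)/p) - (i/p) - ((-j)/p)]_{1 ≤ i,j ≤ (p-3)/2}`. -/
theorem stmt13 (p : ℕ) [Fact p.Prime] (hp : Odd p) (x : ℚ) :
    (Matrix.of fun i j : Fin ((p - 1) / 2) =>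
        x + (legendreSym p ((((i : ℕ) : ℤ) + 1) - (((j : ℕ) : ℤ) + 1)) : ℚ)).det
      = (Matrix.of fun i j : Fin ((p - 1) / 2) =>
          (legendreSym p (((i : ℕ) : ℤ) - ((j : ℕ) : ℤ)) : ℚ)).det
        + x * (Matrix.of fun i j : Fin ((p - 3) / 2) =>
            (legendreSym p ((((i : ℕ) : ℤ) + 1) - (((j : ℕ) : ℤ) + 1)) : ℚ)
              - (legendreSym p (((i : ℕ) : ℤ) + 1) : ℚ)
              - (legendreSym p (-(((j : ℕ) : ℤ) + 1)) : ℚ)).det := by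
  by_cases h3 : p < 3
  · have := (Fact.out : p.Prime).two_le
    obtain ⟨k, hk⟩ := hp
    omega
  obtain ⟨n, hn⟩ : ∃ n, (p - 3) / 2 = n := ⟨_, rfl⟩
  have hn' : (p - 1) / 2 = n + 1 := by omega
  rw [hn, hn']
  have key := Matrix.det_const_add (Matrix.of fun i j : Fin (n + 1) =>
    (legendreSym p (((i : ℕ) : ℤ) - ((j : ℕ) : ℤ)) : ℚ)) x
  simpa [legendreSym.at_zero] using key
end
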